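/- Let T > 0, β ∈ (0,1), and let ξ₀ ∈ L²(𝕋²) be mean-zero. Let ξ : [0,T] → L²(𝕋²) be mean-zero with sup_{t∈[0,T]} ‖ξ_t‖_{L²} ≤ ‖ξ₀‖_{L²} and ∫₀ᵀ ‖∇ξ_s‖²_{L²} ds ≤ ‖ξ₀‖²_{L²} (as holds for the unique solution of the 2D Navier–Stokes equation in vorticity form with initial datum ξ₀). Then for every z ∈ C⁰_t H^{β−1}(𝕋²) there exists a unique y ∈ C⁰_t H^{β−1}(𝕋²) such that for all t ∈ [0,T]: y_t = − ∫₀ᵗ P_{t−s} [ (K∗y_s)·∇ξ_s + (K∗ξ_s)·∇y_s ] ds + z_t, where the integral converges as a Bochner integral in H^{β−1}(𝕋²). The solution map S : z ↦ y is linear, and there is a universal constant C such that ‖Sz‖_{C⁰H^{β−1}} ≤ exp( C (1+T)(1 + ‖ξ₀‖²_{L²}) ) ‖z‖_{C⁰H^{β−1}} for all z ∈ C⁰_t H^{β−1}. -/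

import Mathlib

open MeasureTheory Filter
open scoped ENNReal NNReal

noncomputable section

namespace GaleatiLuo

/-- The unit box `[0,1)^d ⊆ ℝ^d`, a fundamental domain for the torus `𝕋^d = ℝ^d/ℤ^d`. -/
def box (d : ℕ) : Set (Fin d → ℝ) := Set.univ.pi fun _ => Set.Ico (0 : ℝ) 1

/-- Lebesgue measure restricted to the fundamental domain: the measure of the torus. -/
def μT (d : ℕ) : Measure (Fin d → ℝ) := volume.restrict (box d)

/-- `ℤ^d`-periodicity of a scalar function on `ℝ^d`. -/
def ZPeriodic {d : ℕ} (f : (Fin d → ℝ) → ℝ) : Prop :=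
  ∀ (x : Fin d → ℝ) (k : Fin d → ℤ), f (x + fun i => (k i : ℝ)) = f x

/-- `ℤ^d`-periodicity of a vector field on `ℝ^d`. -/
def ZPeriodicV {d : ℕ} (h : (Fin d → ℝ) → Fin d → ℝ) : Prop :=
  ∀ (x : Fin d → ℝ) (k : Fin d → ℤ), h (x + fun i => (k i : ℝ)) = h x

/-- Euclidean norm of a lattice point `k ∈ ℤ^d`. -/
def znorm {d : ℕ} (k : Fin d → ℤ) : ℝ := Real.sqrt (∑ i, ((k i : ℝ)) ^ 2)

/-- The `k`-th Fourier coefficient `f̂(k) = ∫_{[0,1)^d} f(x) e^{-2πik·x} dx`. -/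
def fc {d : ℕ} (f : (Fin d → ℝ) → ℝ) (k : Fin d → ℤ) : ℂ :=
  ∫ x, (f x : ℂ) *
    Complex.exp (-(2 * (Real.pi : ℂ) * Complex.I) * ((∑ i, (k i : ℝ) * x i : ℝ) : ℂ)) ∂(μT d)

/-- Squared Sobolev norm `‖f‖_{H^s}² = Σ_k (1+|k|²)^s |f̂(k)|²` (valued in `ℝ≥0∞`). -/
def sobNormSq {d : ℕ} (s : ℝ) (f : (Fin d → ℝ) → ℝ) : ℝ≥0∞ :=
  ∑' k : Fin d → ℤ, ENNReal.ofReal ((1 + znorm k ^ 2) ^ s) * (‖fc f k‖₊ : ℝ≥0∞) ^ 2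

/-- Sobolev norm `‖f‖_{H^s}`. -/
def sobNorm {d : ℕ} (s : ℝ) (f : (Fin d → ℝ) → ℝ) : ℝ≥0∞ := sobNormSq s f ^ (1 / 2 : ℝ)

/-- Squared `H^s` norm of a vector field (sum over components). -/
def sobNormSqV {d : ℕ} (s : ℝ) (h : (Fin d → ℝ) → Fin d → ℝ) : ℝ≥0∞ :=
  ∑ i, sobNormSq s (fun x => h x i)

/-- `L^p(𝕋^d)` norm. -/
def spLp {d : ℕ} (p : ℝ≥0∞) (f : (Fin d → ℝ) → ℝ) : ℝ≥0∞ := eLpNorm f p (μT d)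

/-- `L^p(𝕋^d)` norm of a vector field. -/
def spLpV {d : ℕ} (p : ℝ≥0∞) (h : (Fin d → ℝ) → Fin d → ℝ) : ℝ≥0∞ := eLpNorm h p (μT d)

/-- Mixed norm `‖u‖_{L^q_t L^p_x}` on `[0,T]` (essential supremum when `q = ∞`). -/
def LqLp {d : ℕ} (T : ℝ) (q p : ℝ≥0∞) (u : ℝ → (Fin d → ℝ) → ℝ) : ℝ≥0∞ :=
  if q = ∞ then essSup (fun t => spLp p (u t)) (volume.restrict (Set.Icc (0:ℝ) T))
  else (∫⁻ t in Set.Icc (0:ℝ) T, spLp p (u t) ^ q.toReal) ^ (1 / q.toReal)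

/-- Mixed norm `‖u‖_{L^q_t L^p_x}` for vector fields. -/
def LqLpV {d : ℕ} (T : ℝ) (q p : ℝ≥0∞) (u : ℝ → (Fin d → ℝ) → Fin d → ℝ) : ℝ≥0∞ :=
  if q = ∞ then essSup (fun t => spLpV p (u t)) (volume.restrict (Set.Icc (0:ℝ) T))
  else (∫⁻ t in Set.Icc (0:ℝ) T, spLpV p (u t) ^ q.toReal) ^ (1 / q.toReal)

/-- `i`-th partial derivative. -/
def pd {d : ℕ} (i : Fin d) (φ : (Fin d → ℝ) → ℝ) : (Fin d → ℝ) → ℝ :=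
  fun x => fderiv ℝ φ x (Pi.single i 1)

/-- Laplacian. -/
def lap {d : ℕ} (φ : (Fin d → ℝ) → ℝ) : (Fin d → ℝ) → ℝ :=
  fun x => ∑ i, pd i (pd i φ) x

/-- `L²(𝕋^d)` pairing `⟨f, g⟩ = ∫_{𝕋^d} f g`. -/
def pairT {d : ℕ} (f g : (Fin d → ℝ) → ℝ) : ℝ := ∫ x, f x * g x ∂(μT d)

/-- Smooth periodic test function. -/
def Test {d : ℕ} (φ : (Fin d → ℝ) → ℝ) : Prop := ContDiff ℝ (⊤ : ℕ∞) φ ∧ ZPeriodic φ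

/-- `D` is the distributional divergence of the vector field `h` on the torus. -/
def IsWeakDiv {d : ℕ} (h : (Fin d → ℝ) → Fin d → ℝ) (D : (Fin d → ℝ) → ℝ) : Prop :=
  ∀ φ, Test φ →
    ∫ x, (∑ i, h x i * pd i φ x) ∂(μT d) = - ∫ x, D x * φ x ∂(μT d)

/-- `g` is the weak spatial gradient of `f` on the torus. -/
def HasWeakGrad {d : ℕ} (f : (Fin d → ℝ) → ℝ) (g : (Fin d → ℝ) → Fin d → ℝ) : Prop :=
  ∀ φ, Test φ → ∀ i,
    ∫ x, f x * pd i φ x ∂(μT d) = - ∫ x, g x i * φ x ∂(μT d)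

/-- Continuity in time with values in `L^p(𝕋^d)`. -/
def ContLp {d : ℕ} (T : ℝ) (p : ℝ≥0∞) (f : ℝ → (Fin d → ℝ) → ℝ) : Prop :=
  ∀ t ∈ Set.Icc (0:ℝ) T, ∀ ε : ℝ, 0 < ε → ∃ δ > (0:ℝ), ∀ s ∈ Set.Icc (0:ℝ) T,
    |s - t| < δ → spLp p (fun x => f s x - f t x) < ENNReal.ofReal ε

/-- Continuity in time with values in `H^{s₀}(𝕋^d)`. -/
def ContSob {d : ℕ} (T s₀ : ℝ) (f : ℝ → (Fin d → ℝ) → ℝ) : Prop :=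
  ∀ t ∈ Set.Icc (0:ℝ) T, ∀ ε : ℝ, 0 < ε → ∃ δ > (0:ℝ), ∀ s ∈ Set.Icc (0:ℝ) T,
    |s - t| < δ → sobNorm s₀ (fun x => f s x - f t x) < ENNReal.ofReal ε

/-- `C⁰_t H^s` norm: `sup_{t∈[0,T]} ‖f_t‖_{H^s}`. -/
def supSob {d : ℕ} (T s : ℝ) (f : ℝ → (Fin d → ℝ) → ℝ) : ℝ≥0∞ :=
  ⨆ t ∈ Set.Icc (0:ℝ) T, sobNorm s (f t)

/-- `sup_{t∈[0,T]} ‖f_t‖_{L^p}`. -/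
def supLp {d : ℕ} (T : ℝ) (p : ℝ≥0∞) (f : ℝ → (Fin d → ℝ) → ℝ) : ℝ≥0∞ :=
  ⨆ t ∈ Set.Icc (0:ℝ) T, spLp p (f t)

/-- `L²_t H¹_x` norm. -/
def L2H1 {d : ℕ} (T : ℝ) (f : ℝ → (Fin d → ℝ) → ℝ) : ℝ≥0∞ :=
  (∫⁻ t in Set.Icc (0:ℝ) T, sobNormSq 1 (f t)) ^ (1 / 2 : ℝ)

/-- A measurable periodic path, bounded in `L^∞([0,T]×𝕋^d)`. -/
def BddClass {d : ℕ} (T : ℝ) (f : ℝ → (Fin d → ℝ) → ℝ) : Prop :=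
  Measurable (Function.uncurry f) ∧ (∀ t, ZPeriodic (f t)) ∧ LqLp T ∞ ∞ f < ∞

/-- Membership in `L^∞_t L²_x ∩ L²_t H¹_x` (with a weak spatial gradient). -/
def SolClassL2 {d : ℕ} (T : ℝ) (f : ℝ → (Fin d → ℝ) → ℝ) : Prop :=
  Measurable (Function.uncurry f) ∧ (∀ t, ZPeriodic (f t)) ∧ supLp T 2 f < ∞ ∧
  ∃ g : ℝ → (Fin d → ℝ) → Fin d → ℝ,
    (∀ t ∈ Set.Icc (0:ℝ) T, HasWeakGrad (f t) (g t)) ∧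
    (∫⁻ t in Set.Icc (0:ℝ) T, (spLp 2 (f t) ^ 2 + spLpV 2 (g t) ^ 2)) < ∞

end GaleatiLuo
namespace GaleatiLuo

/-- Squared `H^s(𝕋²)` norm of a distribution given by its Fourier coefficients. -/
def coefSobSq (s : ℝ) (a : (Fin 2 → ℤ) → ℂ) : ℝ≥0∞ :=
  ∑' k : Fin 2 → ℤ, ENNReal.ofReal ((1 + znorm k ^ 2) ^ s) * (‖a k‖₊ : ℝ≥0∞) ^ 2

/-- `H^s` norm of a coefficient sequence. -/
def coefSobNorm (s : ℝ) (a : (Fin 2 → ℤ) → ℂ) : ℝ≥0∞ := coefSobSq s a ^ (1 / 2 : ℝ)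

/-- `C⁰_t H^s` norm of a coefficient path. -/
def supCoefSob (T s : ℝ) (y : ℝ → (Fin 2 → ℤ) → ℂ) : ℝ≥0∞ :=
  ⨆ t ∈ Set.Icc (0:ℝ) T, coefSobNorm s (y t)

/-- Continuity in time in `H^s` of a coefficient path. -/
def ContCoefSob (T s : ℝ) (y : ℝ → (Fin 2 → ℤ) → ℂ) : Prop :=
  ∀ t ∈ Set.Icc (0:ℝ) T, ∀ ε : ℝ, 0 < ε → ∃ δ > (0:ℝ), ∀ t' ∈ Set.Icc (0:ℝ) T,
    |t' - t| < δ → coefSobNorm s (fun k => y t' k - y t k) < ENNReal.ofReal ε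

/-- A path in `C⁰_t H^s(𝕋²)` of real distributions, in Fourier-coefficient form. -/
def CoefPathClass (T s : ℝ) (y : ℝ → (Fin 2 → ℤ) → ℂ) : Prop :=
  (∀ t k, y t (-k) = star (y t k)) ∧ ContCoefSob T s y ∧ supCoefSob T s y < ∞

/-- The Biot–Savart Fourier multiplier: `m(l) = −i l^⊥/(2π|l|²)` for `l ≠ 0`,
`m(0) = 0`, so that `(K∗w)^(l) = m(l) ŵ(l)`. -/
def bsm (l : Fin 2 → ℤ) (j : Fin 2) : ℂ :=
  if l = 0 then 0
  else -Complex.I * (if j = 0 then -(l 1 : ℂ) else (l 0 : ℂ))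
        / (2 * (Real.pi : ℂ) * ((znorm l : ℝ) : ℂ) ^ 2)

/-- `k`-th Fourier coefficient of `(K∗y)·∇ξ + (K∗ξ)·∇y = div((K∗y)ξ) + div((K∗ξ)y)`,
for a vorticity `ξ` (a function) and a fluctuation `y` (a coefficient sequence):
`(2πi) Σ_l [Σ_j k_j (m_j(l) + m_j(k−l))] ξ̂(k−l) y(l)`. -/
def eulerConv (ξs : (Fin 2 → ℝ) → ℝ) (a : (Fin 2 → ℤ) → ℂ) (k : Fin 2 → ℤ) : ℂ :=
  (2 * (Real.pi : ℂ) * Complex.I) *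
    ∑' l : Fin 2 → ℤ,
      (∑ j, (k j : ℂ) * (bsm l j + bsm (k - l) j)) * fc ξs (k - l) * a l

/-- `‖∇f‖²_{L²(𝕋²)} = Σ_k (2π|k|)² |f̂(k)|²`. -/
def fourierGradSq (f : (Fin 2 → ℝ) → ℝ) : ℝ≥0∞ :=
  ∑' k : Fin 2 → ℤ, ENNReal.ofReal ((2 * Real.pi * znorm k) ^ 2) * (‖fc f k‖₊ : ℝ≥0∞) ^ 2

/-- Mild solution of `y_t = −∫₀ᵗ P_{t−s}[(K∗y_s)·∇ξ_s + (K∗ξ_s)·∇y_s] ds + z_t`,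
written on Fourier coefficients; the convolution sums converge absolutely and the
time integrals converge. -/
def IsMildSol (T : ℝ) (ξ : ℝ → (Fin 2 → ℝ) → ℝ) (z y : ℝ → (Fin 2 → ℤ) → ℂ) : Prop :=
  ∀ t ∈ Set.Icc (0:ℝ) T, ∀ k : Fin 2 → ℤ,
    (∀ s ∈ Set.Ioc (0:ℝ) t, Summable (fun l : Fin 2 → ℤ =>
      ‖(∑ j, (k j : ℂ) * (bsm l j + bsm (k - l) j)) * fc (ξ s) (k - l) * y s l‖)) ∧
    MeasureTheory.IntegrableOn
      (fun s => ((Real.exp (-(4 * Real.pi ^ 2 * znorm k ^ 2) * (t - s)) : ℝ) : ℂ)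
        * eulerConv (ξ s) (y s) k) (Set.Ioc (0:ℝ) t) ∧
    y t k = -(∫ s in Set.Ioc (0:ℝ) t,
        ((Real.exp (-(4 * Real.pi ^ 2 * znorm k ^ 2) * (t - s)) : ℝ) : ℂ)
          * eulerConv (ξ s) (y s) k) + z t k

/-- Cauchy–Schwarz for the Lebesgue integral of extended nonnegative functions. -/
lemma lintegral_mul_sq_le {α : Type*} [MeasurableSpace α] (μ : Measure α) {f g : α → ℝ≥0∞}
    (hf : AEMeasurable f μ) (hg : AEMeasurable g μ) :
    (∫⁻ a, f a * g a ∂μ) ^ 2 ≤ (∫⁻ a, f a ^ 2 ∂μ) * ∫⁻ a, g a ^ 2 ∂μ := by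
  have h := ENNReal.lintegral_mul_le_Lp_mul_Lq μ Real.HolderConjugate.two_two hf hg
  simp only [Pi.mul_apply, ENNReal.rpow_two] at h
  calc (∫⁻ a, f a * g a ∂μ) ^ 2
      ≤ ((∫⁻ a, f a ^ 2 ∂μ) ^ (1 / 2 : ℝ) * (∫⁻ a, g a ^ 2 ∂μ) ^ (1 / 2 : ℝ)) ^ 2 := by gcongr
    _ = _ := by
      rw [mul_pow, ← ENNReal.rpow_two, ← ENNReal.rpow_two, ← ENNReal.rpow_mul,
        ← ENNReal.rpow_mul]
      norm_num

/-- Cauchy–Schwarz for sums of extended nonnegative numbers. -/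
lemma tsum_mul_sq_le {ι : Type*} (f g : ι → ℝ≥0∞) :
    (∑' i, f i * g i) ^ 2 ≤ (∑' i, f i ^ 2) * ∑' i, g i ^ 2 := by
  let _ : MeasurableSpace ι := ⊤
  simpa only [lintegral_count] using
    lintegral_mul_sq_le (Measure.count : Measure ι) (f := f) (g := g)
      measurable_from_top.aemeasurable measurable_from_top.aemeasurable

lemma add_sq_le_two_mul (a b : ℝ≥0∞) : (a + b) ^ 2 ≤ 2 * (a ^ 2 + b ^ 2) := by
  have h := ENNReal.rpow_add_le_mul_rpow_add_rpow a b (p := 2) (by norm_num)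
  norm_num at h
  exact h

/-- For an integrable function `g` with primitive `G`, `∫ g G ^ n = G ^ (n + 1) / (n + 1)`. -/
lemma integral_mul_primitive_pow {g : ℝ → ℝ} {t : ℝ} (hg : IntervalIntegrable g volume 0 t)
    (n : ℕ) :
    ∫ s in (0:ℝ)..t, g s * (∫ r in (0:ℝ)..s, g r) ^ n
      = (∫ r in (0:ℝ)..t, g r) ^ (n + 1) / (n + 1) := by
  set G : ℝ → ℝ := fun s => ∫ r in (0:ℝ)..s, g r with hG
  have hGac : AbsolutelyContinuousOnInterval G 0 t :=
    hg.absolutelyContinuousOnInterval_intervalIntegral (c := 0) (by simp)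
  have hpow : ∀ m : ℕ, AbsolutelyContinuousOnInterval (fun s => G s ^ (m + 1)) 0 t := by
    intro m
    induction m with
    | zero => simpa using hGac
    | succ m ih => simpa only [pow_succ _ (m + 1)] using ih.fun_mul hGac
  have hint := (hpow n).integral_deriv_eq_sub
  have h0 : G 0 = 0 := by simp [hG]
  rw [h0, zero_pow (Nat.succ_ne_zero n), sub_zero] at hint
  rw [← hint, ← intervalIntegral.integral_div]
  apply intervalIntegral.integral_congr_ae
  filter_upwards [hg.ae_hasDerivAt_integral] with x hx hx'
  have hd : HasDerivAt G (g x) x := hx (Set.uIoc_subset_uIcc hx') 0 (by simp)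
  have := (hd.pow (n + 1)).deriv
  have h2 : deriv (fun s => G s ^ (n + 1)) x = ((n + 1 : ℕ) : ℝ) * G x ^ n * g x := by
    simpa [Pi.pow_def] using this
  rw [h2]
  change g x * G x ^ n = _
  push_cast
  field_simp

/-- The measurability of the primitive of an extended nonnegative function. -/
lemma measurable_lintegral_Ioc (γ : ℝ → ℝ≥0∞) :
    Measurable fun s : ℝ => ∫⁻ r in Set.Ioc (0:ℝ) s, γ r :=
  Monotone.measurable fun _ _ h => lintegral_mono_set (Set.Ioc_subset_Ioc_right h)

lemma lintegral_mul_primitive_pow_le {γ : ℝ → ℝ≥0∞} (hγ : Measurable γ) {t : ℝ} (ht : 0 ≤ t)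
    (hfin : ∫⁻ s in Set.Ioc (0:ℝ) t, γ s ≠ ∞) (n : ℕ) :
    ∫⁻ s in Set.Ioc (0:ℝ) t, γ s * (∫⁻ r in Set.Ioc (0:ℝ) s, γ r) ^ n
      ≤ (∫⁻ s in Set.Ioc (0:ℝ) t, γ s) ^ (n + 1) / (n + 1) := by
  set g : ℝ → ℝ := fun s => (γ s).toReal with hgdef
  have hgI : IntegrableOn g (Set.Ioc 0 t) := integrable_toReal_of_lintegral_ne_top
    hγ.aemeasurable hfin
  have hgi : IntervalIntegrable g volume 0 t := by
    rwa [intervalIntegrable_iff_integrableOn_Ioc_of_le ht]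
  have hγfin : ∀ᵐ s ∂(volume.restrict (Set.Ioc 0 t)), γ s < ∞ :=
    ae_lt_top hγ hfin
  have hJ : ∀ s ∈ Set.Icc 0 t, ∫⁻ r in Set.Ioc (0:ℝ) s, γ r
      = ENNReal.ofReal (∫ r in (0:ℝ)..s, g r) := by
    intro s hs
    have hsub : Set.Ioc 0 s ⊆ Set.Ioc 0 t := Set.Ioc_subset_Ioc_right hs.2
    rw [intervalIntegral.integral_of_le hs.1, ofReal_integral_eq_lintegral_ofReal
      (hgI.mono_set hsub) (ae_of_all _ fun _ => ENNReal.toReal_nonneg)]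
    refine lintegral_congr_ae ?_
    filter_upwards [ae_restrict_of_ae_restrict_of_subset hsub hγfin] with r hr
    exact (ENNReal.ofReal_toReal hr.ne).symm
  have hGnn : ∀ s ∈ Set.Icc 0 t, 0 ≤ ∫ r in (0:ℝ)..s, g r := fun s hs =>
    intervalIntegral.integral_nonneg hs.1 fun _ _ => ENNReal.toReal_nonneg
  have hcont : ContinuousOn (fun s => (∫ r in (0:ℝ)..s, g r) ^ n) (Set.uIcc 0 t) :=
    (hgi.absolutelyContinuousOnInterval_intervalIntegral (c := 0) (by simp)).continuousOn.pow n
  have hprod := hgi.mul_continuousOn hcont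
  have key : ∫⁻ s in Set.Ioc (0:ℝ) t, γ s * (∫⁻ r in Set.Ioc (0:ℝ) s, γ r) ^ n
      = ENNReal.ofReal (∫ s in (0:ℝ)..t, g s * (∫ r in (0:ℝ)..s, g r) ^ n) := by
    rw [intervalIntegral.integral_of_le ht, ofReal_integral_eq_lintegral_ofReal
      ((intervalIntegrable_iff_integrableOn_Ioc_of_le ht).1 hprod)]
    · refine lintegral_congr_ae ?_
      filter_upwards [hγfin, ae_restrict_mem measurableSet_Ioc] with s hs hs'
      have hs'' : s ∈ Set.Icc 0 t := Set.Ioc_subset_Icc_self hs'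
      rw [hJ s hs'', ENNReal.ofReal_mul ENNReal.toReal_nonneg, ENNReal.ofReal_toReal hs.ne,
        ENNReal.ofReal_pow (hGnn s hs'')]
    · filter_upwards [ae_restrict_mem measurableSet_Ioc] with s hs'
      exact mul_nonneg ENNReal.toReal_nonneg (pow_nonneg (hGnn s (Set.Ioc_subset_Icc_self hs')) n)
  rw [key, integral_mul_primitive_pow hgi, hJ t ⟨ht, le_rfl⟩,
    ENNReal.ofReal_div_of_pos (by positivity), ENNReal.ofReal_pow (hGnn t ⟨ht, le_rfl⟩)]
  gcongr
  rw [ENNReal.ofReal_add (by positivity) (by norm_num)]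
  simp

/-- One step of the Picard iteration for a linear Volterra inequality. -/
lemma volterra_step {γ : ℝ → ℝ≥0∞} (hγ : Measurable γ) {t : ℝ} (ht : 0 ≤ t)
    (hfin : ∫⁻ s in Set.Ioc (0:ℝ) t, γ s ≠ ∞) (κ : ℝ≥0∞) (n : ℕ) :
    κ * ∫⁻ s in Set.Ioc (0:ℝ) t, γ s * ((κ * ∫⁻ r in Set.Ioc (0:ℝ) s, γ r) ^ n / (n.factorial : ℝ≥0∞))
      ≤ (κ * ∫⁻ r in Set.Ioc (0:ℝ) t, γ r) ^ (n + 1) / ((n + 1).factorial : ℝ≥0∞) := by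
  have hm : Measurable fun s => γ s * (∫⁻ r in Set.Ioc (0:ℝ) s, γ r) ^ n :=
    hγ.mul ((measurable_lintegral_Ioc γ).pow_const n)
  have h1 : ∀ s, γ s * ((κ * ∫⁻ r in Set.Ioc (0:ℝ) s, γ r) ^ n / (n.factorial : ℝ≥0∞))
      = (κ ^ n / (n.factorial : ℝ≥0∞)) * (γ s * (∫⁻ r in Set.Ioc (0:ℝ) s, γ r) ^ n) := by
    intro s
    rw [mul_pow, div_eq_mul_inv, div_eq_mul_inv]; ring
  simp_rw [h1]
  rw [lintegral_const_mul _ hm]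
  calc _ ≤ κ * (κ ^ n / (n.factorial : ℝ≥0∞) *
        ((∫⁻ s in Set.Ioc (0:ℝ) t, γ s) ^ (n + 1) / (n + 1))) := by
        gcongr
        exact lintegral_mul_primitive_pow_le hγ ht hfin n
    _ = _ := by
        rw [Nat.factorial_succ, mul_pow, div_eq_mul_inv, div_eq_mul_inv, div_eq_mul_inv]
        push_cast
        rw [ENNReal.mul_inv (by left; positivity) (by left; finiteness)]
        ring

/-- Grönwall's inequality for a bounded function and an integrable kernel. -/
lemma volterra_gronwall {γ Y : ℝ → ℝ≥0∞} (hγ : Measurable γ) {T Γ κ : ℝ} (hΓ : 0 ≤ Γ) (hκ : 0 ≤ κ)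
    (hfin : ∫⁻ s in Set.Ioc (0:ℝ) T, γ s ≤ ENNReal.ofReal Γ) {B M : ℝ≥0∞} (hM : M ≠ ∞)
    (hYM : ∀ t ∈ Set.Icc (0:ℝ) T, Y t ≤ M)
    (hY : ∀ t ∈ Set.Icc (0:ℝ) T,
      Y t ≤ B + ENNReal.ofReal κ * ∫⁻ s in Set.Ioc (0:ℝ) t, γ s * Y s) :
    ∀ t ∈ Set.Icc (0:ℝ) T, Y t ≤ B * ENNReal.ofReal (Real.exp (κ * Γ)) := by
  set J : ℝ → ℝ≥0∞ := fun s => ∫⁻ r in Set.Ioc (0:ℝ) s, γ r with hJ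
  set p : ℕ → ℝ → ℝ≥0∞ := fun j s => (ENNReal.ofReal κ * J s) ^ j / (j.factorial : ℝ≥0∞) with hp
  have hJm : Measurable J := measurable_lintegral_Ioc γ
  have hpm : ∀ j, Measurable (p j) := fun j => ((hJm.const_mul _).pow_const j).div_const _
  have hJΓ : ∀ t ∈ Set.Icc (0:ℝ) T, J t ≤ ENNReal.ofReal Γ := fun t ht =>
    (lintegral_mono_set (Set.Ioc_subset_Ioc_right ht.2)).trans hfin
  have hstep : ∀ t ∈ Set.Icc (0:ℝ) T, ∀ j, ENNReal.ofReal κ * ∫⁻ s in Set.Ioc (0:ℝ) t, γ s * p j s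
      ≤ p (j + 1) t := fun t ht j =>
    volterra_step hγ ht.1 (ne_top_of_le_ne_top ENNReal.ofReal_ne_top (hJΓ t ht)) _ j
  have hiter : ∀ n : ℕ, ∀ t ∈ Set.Icc (0:ℝ) T,
      Y t ≤ B * ∑ j ∈ Finset.range n, p j t + M * p n t := by
    intro n
    induction n with
    | zero => intro t ht; simpa [hp] using hYM t ht
    | succ n ih =>
      intro t ht
      have hmj : ∀ j, Measurable fun s => γ s * p j s := fun j => hγ.mul (hpm j)
      have hm2 : Measurable fun s => γ s * p n s := hmj n
      have hm1 : Measurable fun s => ∑ j ∈ Finset.range n, γ s * p j s :=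
        Finset.measurable_fun_sum _ fun j _ => hγ.mul (hpm j)
      calc Y t ≤ B + ENNReal.ofReal κ * ∫⁻ s in Set.Ioc (0:ℝ) t, γ s * Y s := hY t ht
        _ ≤ B + ENNReal.ofReal κ * ∫⁻ s in Set.Ioc (0:ℝ) t,
              (B * (∑ j ∈ Finset.range n, γ s * p j s) + M * (γ s * p n s)) := by
            gcongr 2
            refine setLIntegral_mono ((hm1.const_mul _).add (hm2.const_mul _)) fun s hs => ?_
            calc γ s * Y s ≤ γ s * (B * ∑ j ∈ Finset.range n, p j s + M * p n s) := by
                  gcongr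
                  exact ih s ⟨hs.1.le, hs.2.trans ht.2⟩
              _ = _ := by rw [← Finset.mul_sum]; ring
        _ = B + (B * ∑ j ∈ Finset.range n,
              (ENNReal.ofReal κ * ∫⁻ s in Set.Ioc (0:ℝ) t, γ s * p j s) +
              M * (ENNReal.ofReal κ * ∫⁻ s in Set.Ioc (0:ℝ) t, γ s * p n s)) := by
            rw [lintegral_add_left (hm1.const_mul _), lintegral_const_mul _ hm1,
              lintegral_const_mul _ hm2,
              lintegral_finsetSum _ fun j _ => hmj j, ← Finset.mul_sum]
            ring
        _ ≤ B + (B * ∑ j ∈ Finset.range n, p (j + 1) t + M * p (n + 1) t) := by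
            gcongr with j hj
            · exact hstep t ht j
            · exact hstep t ht n
        _ = _ := by
            rw [Finset.sum_range_succ']
            simp only [hp, pow_zero, Nat.factorial_zero, Nat.cast_one, div_one]
            ring
  have hpΓ : ∀ t ∈ Set.Icc (0:ℝ) T, ∀ j, p j t ≤ ENNReal.ofReal ((κ * Γ) ^ j / j.factorial) := by
    intro t ht j
    rw [ENNReal.ofReal_div_of_pos (by positivity), ENNReal.ofReal_pow (by positivity),
      ENNReal.ofReal_mul hκ, ENNReal.ofReal_natCast]
    simp only [hp]
    gcongr
    exact hJΓ t ht
  intro t ht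
  have hlim : Tendsto (fun n : ℕ => B * ENNReal.ofReal (Real.exp (κ * Γ))
      + M * ENNReal.ofReal ((κ * Γ) ^ n / n.factorial)) atTop
      (nhds (B * ENNReal.ofReal (Real.exp (κ * Γ)) + M * ENNReal.ofReal 0)) := by
    refine tendsto_const_nhds.add (ENNReal.Tendsto.const_mul ?_ (Or.inr hM))
    exact ENNReal.tendsto_ofReal (FloorSemiring.tendsto_pow_div_factorial_atTop (κ * Γ))
  rw [ENNReal.ofReal_zero, mul_zero, add_zero] at hlim
  refine ge_of_tendsto' hlim fun n => (hiter n t ht).trans ?_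
  gcongr
  · calc ∑ j ∈ Finset.range n, p j t
        ≤ ∑ j ∈ Finset.range n, ENNReal.ofReal ((κ * Γ) ^ j / j.factorial) :=
          Finset.sum_le_sum fun j _ => hpΓ t ht j
      _ = ENNReal.ofReal (∑ j ∈ Finset.range n, (κ * Γ) ^ j / j.factorial) :=
          (ENNReal.ofReal_sum_of_nonneg fun j _ => by positivity).symm
      _ ≤ _ := ENNReal.ofReal_le_ofReal (Real.sum_le_exp_of_nonneg (by positivity) n)
  · exact hpΓ t ht n

lemma znorm_nonneg {d : ℕ} (k : Fin d → ℤ) : 0 ≤ znorm k := Real.sqrt_nonneg _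

lemma znorm_sq_eq (k : Fin 2 → ℤ) : znorm k ^ 2 = (k 0 : ℝ) ^ 2 + (k 1 : ℝ) ^ 2 := by
  rw [znorm, Real.sq_sqrt (by positivity), Fin.sum_univ_two]

lemma znorm_zero : znorm (0 : Fin 2 → ℤ) = 0 := by simp [znorm]

lemma one_le_znorm {k : Fin 2 → ℤ} (hk : k ≠ 0) : 1 ≤ znorm k := by
  have h : (1 : ℤ) ≤ k 0 ^ 2 + k 1 ^ 2 := by
    by_contra! hlt
    apply hk
    have h0 : k 0 = 0 := by nlinarith [sq_nonneg (k 0), sq_nonneg (k 1)]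
    have h1 : k 1 = 0 := by nlinarith [sq_nonneg (k 0), sq_nonneg (k 1)]
    funext i
    fin_cases i <;> simp [h0, h1]
  have h' : (1 : ℝ) ≤ znorm k ^ 2 := by rw [znorm_sq_eq]; exact_mod_cast h
  nlinarith [znorm_nonneg k]

lemma znorm_eq_norm {d : ℕ} (k : Fin d → ℤ) :
    znorm k = ‖(WithLp.toLp 2 (fun i => (k i : ℝ)) : EuclideanSpace ℝ (Fin d))‖ := by
  rw [EuclideanSpace.norm_eq, znorm]
  simp

lemma znorm_le_add_sub {d : ℕ} (k l : Fin d → ℤ) : znorm l ≤ znorm k + znorm (k - l) := by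
  simp only [znorm_eq_norm]
  refine (le_of_eq ?_).trans (norm_sub_le _ _)
  congr 1
  ext i
  simp

/-- The Japanese bracket `√(1 + |k|²)`. -/
def jb (k : Fin 2 → ℤ) : ℝ := Real.sqrt (1 + znorm k ^ 2)

lemma jb_sq (k : Fin 2 → ℤ) : jb k ^ 2 = 1 + znorm k ^ 2 := Real.sq_sqrt (by positivity)

lemma one_le_jb (k : Fin 2 → ℤ) : 1 ≤ jb k := by
  rw [jb, Real.one_le_sqrt]; nlinarith [sq_nonneg (znorm k)]

lemma jb_pos (k : Fin 2 → ℤ) : 0 < jb k := zero_lt_one.trans_le (one_le_jb k)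

lemma znorm_le_jb (k : Fin 2 → ℤ) : znorm k ≤ jb k :=
  Real.le_sqrt_of_sq_le (by linarith)

lemma jb_le_add (k l : Fin 2 → ℤ) : jb l ≤ jb k + znorm (k - l) := by
  refine Real.sqrt_le_iff.2 ⟨add_nonneg (jb_pos k).le (znorm_nonneg _), ?_⟩
  have h1 := znorm_le_add_sub k l
  nlinarith [jb_sq k, znorm_le_jb k, znorm_nonneg k, znorm_nonneg l, znorm_nonneg (k - l),
    mul_nonneg (sub_nonneg.2 (znorm_le_jb k)) (znorm_nonneg (k - l))]

lemma jb_le_two_mul {k : Fin 2 → ℤ} (hk : k ≠ 0) : jb k ≤ 2 * znorm k := by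
  have := one_le_znorm hk
  refine Real.sqrt_le_iff.2 ⟨by linarith, by nlinarith⟩

/-- The Sobolev weight `(1 + |k|²)^{s/2}`. -/
def wt (s : ℝ) (k : Fin 2 → ℤ) : ℝ := jb k ^ s

lemma wt_pos (s : ℝ) (k : Fin 2 → ℤ) : 0 < wt s k := Real.rpow_pos_of_pos (jb_pos k) s

lemma wt_sq (s : ℝ) (k : Fin 2 → ℤ) : wt s k ^ 2 = (1 + znorm k ^ 2) ^ s := by
  rw [wt, ← Real.rpow_natCast, ← Real.rpow_mul (jb_pos k).le, ← jb_sq,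
    ← Real.rpow_natCast (jb k) 2, ← Real.rpow_mul (jb_pos k).le, mul_comm]

lemma coefSobSq_eq (s : ℝ) (a : (Fin 2 → ℤ) → ℂ) :
    coefSobSq s a = ∑' k, (ENNReal.ofReal (wt s k) * ‖a k‖ₑ) ^ 2 := by
  refine tsum_congr fun k => ?_
  rw [mul_pow, ← ENNReal.ofReal_pow (wt_pos s k).le, wt_sq]
  rfl

/-- The symbol of the bilinear operator `(ξ, y) ↦ div ((K ∗ y) ξ) + div ((K ∗ ξ) y)`. -/
def eulerSymbol (k l : Fin 2 → ℤ) : ℂ := ∑ j, (k j : ℂ) * (bsm l j + bsm (k - l) j)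

lemma norm_sum_mul_bsm_le (k l : Fin 2 → ℤ) :
    ‖∑ j, (k j : ℂ) * bsm l j‖ ≤ znorm k * (znorm l)⁻¹ := by
  by_cases hl : l = 0
  · simp [bsm, hl, znorm_zero]
  have hl1 := one_le_znorm hl
  have hlpos : 0 < znorm l := by linarith
  have hpi := Real.pi_gt_three
  have heq : ∑ j, (k j : ℂ) * bsm l j
      = -Complex.I * (((-(k 0 : ℝ) * l 1 + k 1 * l 0) / (2 * Real.pi * znorm l ^ 2) : ℝ) : ℂ) := by
    rw [Fin.sum_univ_two]
    simp only [bsm, hl, if_false, if_true, one_ne_zero]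
    push_cast
    ring
  rw [heq, norm_mul, norm_neg, Complex.norm_I, one_mul, Complex.norm_real, Real.norm_eq_abs,
    abs_div, abs_of_pos (by positivity : 0 < 2 * Real.pi * znorm l ^ 2), div_le_iff₀ (by positivity)]
  have h1 : |(-(k 0 : ℝ) * l 1 + k 1 * l 0)| ≤ znorm k * znorm l := by
    refine abs_le_of_sq_le_sq ?_ (mul_nonneg (znorm_nonneg _) (znorm_nonneg _))
    rw [mul_pow, znorm_sq_eq, znorm_sq_eq]
    nlinarith [sq_nonneg ((k 0 : ℝ) * l 0 + k 1 * l 1)]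
  have h2 : znorm k * (znorm l)⁻¹ * (2 * Real.pi * znorm l ^ 2)
      = 2 * Real.pi * (znorm k * znorm l) := by field_simp
  rw [h2]
  nlinarith [mul_nonneg (znorm_nonneg k) (znorm_nonneg l)]

lemma norm_eulerSymbol_le (k l : Fin 2 → ℤ) :
    ‖eulerSymbol k l‖ ≤ znorm k * ((znorm l)⁻¹ + (znorm (k - l))⁻¹) := by
  have : eulerSymbol k l = ∑ j, (k j : ℂ) * bsm l j + ∑ j, (k j : ℂ) * bsm (k - l) j := by
    rw [eulerSymbol, ← Finset.sum_add_distrib]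
    simp only [mul_add]
  rw [this, mul_add]
  exact (norm_add_le _ _).trans (add_le_add (norm_sum_mul_bsm_le k l) (norm_sum_mul_bsm_le k _))

lemma wt_le_mul_wt {σ : ℝ} (h0 : σ ≤ 0) (h1 : -1 ≤ σ) (k l : Fin 2 → ℤ) :
    wt σ k ≤ (1 + jb l / jb k) * wt σ l := by
  have hx : 0 < jb l / jb k := div_pos (jb_pos l) (jb_pos k)
  have key : (jb l / jb k) ^ (-σ) ≤ 1 + jb l / jb k := by
    rcases le_total (jb l / jb k) 1 with h | h
    · linarith [Real.rpow_le_one hx.le h (by linarith : 0 ≤ -σ)]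
    · have := Real.rpow_le_rpow_of_exponent_le h (by linarith : -σ ≤ 1)
      rw [Real.rpow_one] at this
      linarith
  have heq : wt σ k = (jb l / jb k) ^ (-σ) * wt σ l := by
    rw [wt, wt, Real.div_rpow (jb_pos l).le (jb_pos k).le, Real.rpow_neg (jb_pos l).le,
      Real.rpow_neg (jb_pos k).le]
    have := (Real.rpow_pos_of_pos (jb_pos l) σ).ne'
    have := (Real.rpow_pos_of_pos (jb_pos k) σ).ne'
    field_simp
  rw [heq]
  exact mul_le_mul_of_nonneg_right key (wt_pos σ l).le

lemma inv_znorm_le (l : Fin 2 → ℤ) : (znorm l)⁻¹ ≤ 2 * (jb l)⁻¹ := by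
  by_cases hl : l = 0
  · rw [hl, znorm_zero, inv_zero]; have := jb_pos 0; positivity
  · have h := jb_le_two_mul hl
    have h1 := one_le_znorm hl
    have := jb_pos l
    rw [inv_eq_one_div, ← div_eq_mul_inv, div_le_div_iff₀ (by linarith) this]
    linarith

/-- The square-summable majorant `1 / (1 + |k|²)`. -/
def rq (k : Fin 2 → ℤ) : ℝ := (jb k)⁻¹ ^ 2

/-- The uniform bound on the weighted symbol. -/
lemma weighted_symbol_le {σ : ℝ} (h0 : σ ≤ 0) (h1 : -1 ≤ σ) {k l : Fin 2 → ℤ} (hp : k - l ≠ 0) :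
    wt σ k * ‖eulerSymbol k l‖
      ≤ znorm k * (16 * (rq (k - l) + rq l + rq k) * znorm (k - l)) * wt σ l := by
  set K := (jb k)⁻¹ with hK
  set A := (jb l)⁻¹ with hA
  set P := (jb (k - l))⁻¹ with hP
  have hKp : 0 < K := inv_pos.2 (jb_pos k)
  have hAp : 0 < A := inv_pos.2 (jb_pos l)
  have hPp : 0 < P := inv_pos.2 (jb_pos _)
  have hz1 := one_le_znorm hp
  have hPz : 1 ≤ 2 * (znorm (k - l) * P) := by
    have := jb_le_two_mul hp
    rw [hP, ← mul_assoc, ← div_eq_mul_inv, le_div_iff₀ (jb_pos _)]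
    linarith
  have hL : jb l ≤ K⁻¹ + P⁻¹ := by
    rw [hK, hP, inv_inv, inv_inv]
    linarith [jb_le_add k l, znorm_le_jb (k - l)]
  have hLP : jb l * K * P ≤ K + P := by
    calc jb l * K * P ≤ (K⁻¹ + P⁻¹) * K * P := by gcongr
      _ = P + K := by field_simp
      _ = _ := add_comm _ _
  have hLA : jb l * A = 1 := mul_inv_cancel₀ (jb_pos l).ne'
  have hsum : (A + P) * (1 + jb l * K) ≤ 4 * (P ^ 2 + A ^ 2 + K ^ 2) * (2 * znorm (k - l)) := by
    have e1 : (A + P) * (1 + jb l * K) * P ≤ 4 * (P ^ 2 + A ^ 2 + K ^ 2) := by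
      have : (A + P) * (1 + jb l * K) * P
          = A * P + P ^ 2 + (jb l * A) * K * P + (jb l * K * P) * P := by ring
      rw [this, hLA]
      have h3 : (jb l * K * P) * P ≤ (K + P) * P := by gcongr
      nlinarith [sq_nonneg (A - P), sq_nonneg (K - P), sq_nonneg (A - K)]
    have e2 : 0 ≤ (A + P) * (1 + jb l * K) := by have := jb_pos l; positivity
    calc (A + P) * (1 + jb l * K) = (A + P) * (1 + jb l * K) * 1 := by ring
      _ ≤ (A + P) * (1 + jb l * K) * (2 * (znorm (k - l) * P)) := by gcongr
      _ = ((A + P) * (1 + jb l * K) * P) * (2 * znorm (k - l)) := by ring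
      _ ≤ _ := by gcongr
  have hwl := wt_pos σ l
  have hzk := znorm_nonneg k
  calc wt σ k * ‖eulerSymbol k l‖
      ≤ ((1 + jb l / jb k) * wt σ l) * (znorm k * ((znorm l)⁻¹ + (znorm (k - l))⁻¹)) := by
        have := jb_pos l
        have := jb_pos k
        exact mul_le_mul (wt_le_mul_wt h0 h1 k l) (norm_eulerSymbol_le k l) (norm_nonneg _)
          (by positivity)
    _ ≤ ((1 + jb l * K) * wt σ l) * (znorm k * (2 * A + 2 * P)) := by
        rw [div_eq_mul_inv]
        have := jb_pos l
        gcongr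
        · exact inv_znorm_le l
        · exact inv_znorm_le _
    _ = znorm k * (2 * ((A + P) * (1 + jb l * K))) * wt σ l := by ring
    _ ≤ znorm k * (2 * (4 * (P ^ 2 + A ^ 2 + K ^ 2) * (2 * znorm (k - l)))) * wt σ l := by gcongr
    _ = _ := by simp only [rq]; ring

lemma summable_rq_sq : Summable fun k : Fin 2 → ℤ => rq k ^ 2 := by
  have h1 : Summable fun n : ℤ => (1 + (n : ℝ) ^ 2)⁻¹ := by
    have hz := Real.summable_one_div_int_pow.2 one_lt_two
    refine Summable.of_norm_bounded_eventually hz ?_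
    filter_upwards [(Set.finite_singleton (0 : ℤ)).compl_mem_cofinite] with n hn
    have hn' : (n : ℝ) ≠ 0 := by simpa using hn
    have : 0 < (n : ℝ) ^ 2 := by positivity
    rw [Real.norm_of_nonneg (by positivity), inv_eq_one_div]
    gcongr
    linarith
  have h2 := (h1.mul_of_nonneg h1 (fun n => by positivity) (fun n => by positivity))
  have h3 := (finTwoArrowEquiv ℤ).summable_iff.2 h2
  refine Summable.of_nonneg_of_le (fun k => by positivity) (fun k => ?_) h3
  simp only [rq, Function.comp, finTwoArrowEquiv_apply]
  rw [inv_pow, jb_sq, inv_pow, ← mul_inv, znorm_sq_eq]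
  gcongr
  change (1 + (k 0 : ℝ) ^ 2) * (1 + (k 1 : ℝ) ^ 2) ≤ _
  nlinarith [sq_nonneg (k 0 : ℝ), sq_nonneg (k 1 : ℝ), mul_nonneg (sq_nonneg (k 0 : ℝ)) (sq_nonneg (k 1 : ℝ))]

/-- The constant `∑ (1 + |k|²)⁻²`. -/
def rqSum : ℝ := ∑' k : Fin 2 → ℤ, rq k ^ 2

lemma rq_nonneg (k : Fin 2 → ℤ) : 0 ≤ rq k := by unfold rq; positivity

lemma tsum_rq_sq : ∑' k : Fin 2 → ℤ, ENNReal.ofReal (rq k) ^ 2 = ENNReal.ofReal rqSum := by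
  rw [rqSum, ENNReal.ofReal_tsum_of_nonneg (fun k => by positivity) summable_rq_sq]
  exact tsum_congr fun k => (ENNReal.ofReal_pow (rq_nonneg k) 2).symm

/-- Majorant of the weighted bilinear term with coefficients `c` and `a`. -/
def convQ (σ : ℝ) (c a : (Fin 2 → ℤ) → ℂ) (k : Fin 2 → ℤ) : ℝ≥0∞ :=
  ∑' l, 16 * (ENNReal.ofReal (rq (k - l)) + ENNReal.ofReal (rq l) + ENNReal.ofReal (rq k)) *
    (ENNReal.ofReal (znorm (k - l)) * ‖c (k - l)‖ₑ) * (ENNReal.ofReal (wt σ l) * ‖a l‖ₑ)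

lemma wt_mul_tsum_symbol_le {σ : ℝ} (h0 : σ ≤ 0) (h1 : -1 ≤ σ) {c : (Fin 2 → ℤ) → ℂ} (hc : c 0 = 0)
    (a : (Fin 2 → ℤ) → ℂ) (k : Fin 2 → ℤ) :
    ENNReal.ofReal (wt σ k) * ∑' l, ‖eulerSymbol k l * c (k - l) * a l‖ₑ
      ≤ ENNReal.ofReal (znorm k) * convQ σ c a k := by
  rw [convQ, ← ENNReal.tsum_mul_left, ← ENNReal.tsum_mul_left]
  refine ENNReal.tsum_le_tsum fun l => ?_
  by_cases hp : k - l = 0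
  · simp [hp, hc]
  have h := ENNReal.ofReal_le_ofReal (weighted_symbol_le h0 h1 hp)
  have hr1 := rq_nonneg (k - l)
  have hr2 := rq_nonneg l
  have hr3 := rq_nonneg k
  have hz1 := znorm_nonneg k
  have hz2 := znorm_nonneg (k - l)
  rw [ENNReal.ofReal_mul (wt_pos σ k).le, ENNReal.ofReal_mul (by positivity),
    ENNReal.ofReal_mul hz1, ENNReal.ofReal_mul (by positivity), ENNReal.ofReal_mul (by norm_num),
    ENNReal.ofReal_add (by positivity) hr3, ENNReal.ofReal_add hr1 hr2, ofReal_norm,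
    ENNReal.ofReal_ofNat] at h
  rw [enorm_mul, enorm_mul]
  calc _ = (ENNReal.ofReal (wt σ k) * ‖eulerSymbol k l‖ₑ) * (‖c (k - l)‖ₑ * ‖a l‖ₑ) := by ring
    _ ≤ _ * (‖c (k - l)‖ₑ * ‖a l‖ₑ) := mul_le_mul_left h _
    _ = _ := by ring

lemma tsum_sub_left_eq (f : (Fin 2 → ℤ) → ℝ≥0∞) (k : Fin 2 → ℤ) :
    ∑' l, f (k - l) = ∑' l, f l :=
  (Equiv.subLeft k).tsum_eq f

lemma tsum_sub_right_eq (f : (Fin 2 → ℤ) → ℝ≥0∞) (l : Fin 2 → ℤ) :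
    ∑' k, f (k - l) = ∑' k, f k :=
  (Equiv.subRight l).tsum_eq f

/-- The bilinear estimate. -/
lemma tsum_convQ_sq_le (σ : ℝ) (c a : (Fin 2 → ℤ) → ℂ) :
    ∑' k, convQ σ c a k ^ 2 ≤ ENNReal.ofReal (2560 * rqSum) *
      ((∑' p, (ENNReal.ofReal (znorm p) * ‖c p‖ₑ) ^ 2) * coefSobSq σ a) := by
  set r : (Fin 2 → ℤ) → ℝ≥0∞ := fun k => ENNReal.ofReal (rq k) with hr
  set f : (Fin 2 → ℤ) → ℝ≥0∞ := fun p => ENNReal.ofReal (znorm p) * ‖c p‖ₑ with hf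
  set g : (Fin 2 → ℤ) → ℝ≥0∞ := fun l => ENNReal.ofReal (wt σ l) * ‖a l‖ₑ with hg
  set R := ENNReal.ofReal rqSum with hR
  have hrR : ∑' k, r k ^ 2 = R := tsum_rq_sq
  rw [coefSobSq_eq]
  change _ ≤ _ * ((∑' p, f p ^ 2) * ∑' l, g l ^ 2)
  set F := ∑' p, f p ^ 2 with hF
  set G := ∑' l, g l ^ 2 with hG
  have hconv : ∑' k, ∑' l, (f (k - l) * g l) ^ 2 = F * G := by
    rw [ENNReal.tsum_comm]
    simp_rw [mul_pow, ENNReal.tsum_mul_right]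
    simp_rw [tsum_sub_right_eq (fun p => f p ^ 2), ENNReal.tsum_mul_left]
    rfl
  have hk : ∀ k, convQ σ c a k ^ 2
      ≤ 512 * (4 * R * ∑' l, (f (k - l) * g l) ^ 2) + 512 * (r k ^ 2 * (F * G)) := by
    intro k
    have h1 : convQ σ c a k
        = 16 * (∑' l, (r (k - l) + r l) * (f (k - l) * g l) + r k * ∑' l, f (k - l) * g l) := by
      rw [convQ, ← ENNReal.tsum_mul_left, ← ENNReal.tsum_add, ← ENNReal.tsum_mul_left]
      refine tsum_congr fun l => ?_
      simp only [hr, hf, hg]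
      ring
    have h2 : (∑' l, (r (k - l) + r l) * (f (k - l) * g l)) ^ 2
        ≤ 4 * R * ∑' l, (f (k - l) * g l) ^ 2 := by
      refine (tsum_mul_sq_le _ _).trans ?_
      gcongr
      calc ∑' l, (r (k - l) + r l) ^ 2 ≤ ∑' l, 2 * (r (k - l) ^ 2 + r l ^ 2) :=
            ENNReal.tsum_le_tsum fun l => add_sq_le_two_mul _ _
        _ = 4 * R := by
            rw [ENNReal.tsum_mul_left, ENNReal.tsum_add, tsum_sub_left_eq (fun p => r p ^ 2), hrR]
            ring
    have h3 : (∑' l, f (k - l) * g l) ^ 2 ≤ F * G := by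
      refine (tsum_mul_sq_le _ _).trans ?_
      rw [tsum_sub_left_eq (fun p => f p ^ 2)]
    rw [h1, mul_pow]
    calc _ ≤ 16 ^ 2 * (2 * ((∑' l, (r (k - l) + r l) * (f (k - l) * g l)) ^ 2
            + (r k * ∑' l, f (k - l) * g l) ^ 2)) := by
          gcongr; exact add_sq_le_two_mul _ _
      _ ≤ 16 ^ 2 * (2 * (4 * R * ∑' l, (f (k - l) * g l) ^ 2 + r k ^ 2 * (F * G))) := by
          rw [mul_pow (r k)]; gcongr
      _ = _ := by ring
  calc ∑' k, convQ σ c a k ^ 2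
      ≤ ∑' k, (512 * (4 * R * ∑' l, (f (k - l) * g l) ^ 2) + 512 * (r k ^ 2 * (F * G))) :=
        ENNReal.tsum_le_tsum hk
    _ = 2560 * R * (F * G) := by
        rw [ENNReal.tsum_add]
        simp_rw [ENNReal.tsum_mul_left, ENNReal.tsum_mul_right]
        rw [hconv, hrR]
        ring
    _ = _ := by rw [ENNReal.ofReal_mul (by norm_num), ENNReal.ofReal_ofNat]

/-- The convolution sums converge absolutely when `c ∈ ℓ²` has mean zero and `a ∈ H^σ`. -/
lemma summable_symbol {σ : ℝ} (h1 : -1 ≤ σ) {c a : (Fin 2 → ℤ) → ℂ} (hc : c 0 = 0)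
    (hc2 : ∑' p, ‖c p‖ₑ ^ 2 ≠ ∞) (ha : coefSobSq σ a ≠ ∞) (k : Fin 2 → ℤ) :
    Summable fun l => ‖eulerSymbol k l * c (k - l) * a l‖ := by
  have hbound : ∀ l, ‖eulerSymbol k l * c (k - l) * a l‖ₑ
      ≤ ENNReal.ofReal (znorm k * (3 + jb k)) *
        (‖c (k - l)‖ₑ * (ENNReal.ofReal (wt σ l) * ‖a l‖ₑ)) := by
    intro l
    by_cases hp : k - l = 0
    · simp [hp, hc]
    have hreal : ‖eulerSymbol k l‖ ≤ znorm k * (3 + jb k) * wt σ l := by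
      have hz := one_le_znorm hp
      have hw : (jb l)⁻¹ ≤ wt σ l := by
        rw [wt, ← Real.rpow_neg_one]
        exact Real.rpow_le_rpow_of_exponent_le (one_le_jb l) h1
      have hzk := znorm_nonneg k
      have hjk := jb_pos k
      refine (norm_eulerSymbol_le k l).trans ?_
      rw [mul_assoc]
      refine mul_le_mul_of_nonneg_left ?_ hzk
      refine le_trans ?_ (mul_le_mul_of_nonneg_left hw (by positivity))
      have h2 : (znorm (k - l))⁻¹ ≤ (1 + jb k) * (jb l)⁻¹ := by
        have hz' : 0 < znorm (k - l) := by linarith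
        have := jb_le_add k l
        rw [← div_eq_mul_inv, inv_eq_one_div, div_le_div_iff₀ hz' (jb_pos l)]
        nlinarith
      calc _ ≤ 2 * (jb l)⁻¹ + (1 + jb k) * (jb l)⁻¹ := add_le_add (inv_znorm_le l) h2
        _ = _ := by ring
    have := ENNReal.ofReal_le_ofReal hreal
    have hzk := znorm_nonneg k
    have hjk := jb_pos k
    rw [ENNReal.ofReal_mul (by positivity), ofReal_norm] at this
    rw [enorm_mul, enorm_mul]
    calc ‖eulerSymbol k l‖ₑ * ‖c (k - l)‖ₑ * ‖a l‖ₑ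
        ≤ ENNReal.ofReal (znorm k * (3 + jb k)) * ENNReal.ofReal (wt σ l) * ‖c (k - l)‖ₑ * ‖a l‖ₑ := by
          gcongr
      _ = _ := by ring
  have hfin : ∑' l, ‖eulerSymbol k l * c (k - l) * a l‖ₑ ≠ ∞ := by
    refine ne_top_of_le_ne_top ?_ (ENNReal.tsum_le_tsum hbound)
    rw [ENNReal.tsum_mul_left]
    refine ENNReal.mul_ne_top ENNReal.ofReal_ne_top fun h => ?_
    have h2 := tsum_mul_sq_le (fun l => ‖c (k - l)‖ₑ) fun l => ENNReal.ofReal (wt σ l) * ‖a l‖ₑ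
    rw [h, tsum_sub_left_eq (fun p => ‖c p‖ₑ ^ 2), ← coefSobSq_eq] at h2
    exact ENNReal.mul_ne_top hc2 ha (top_le_iff.1 (by simpa using h2))
  have := ENNReal.summable_toReal hfin
  simpa using this

/-- The character `e_k(x) = e^{2πi k·x}`. -/
def chr (k : Fin 2 → ℤ) (x : Fin 2 → ℝ) : ℂ :=
  Complex.exp ((2 * (Real.pi : ℂ) * Complex.I) * ((∑ i, (k i : ℝ) * x i : ℝ) : ℂ))

lemma continuous_chr (k : Fin 2 → ℤ) : Continuous (chr k) := by
  unfold chr; fun_prop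

lemma norm_chr (k : Fin 2 → ℤ) (x : Fin 2 → ℝ) : ‖chr k x‖ = 1 := by
  have : chr k x = Complex.exp (((2 * Real.pi * ∑ i, (k i : ℝ) * x i : ℝ) : ℂ) * Complex.I) := by
    rw [chr]; congr 1; push_cast; ring
  rw [this, Complex.norm_exp_ofReal_mul_I]

lemma chr_eq_prod (k : Fin 2 → ℤ) (x : Fin 2 → ℝ) :
    chr k x = ∏ i, Complex.exp (2 * (Real.pi : ℂ) * Complex.I * (k i : ℂ) * (x i : ℂ)) := by
  rw [← Complex.exp_sum, chr]
  congr 1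
  push_cast
  rw [Finset.mul_sum]
  exact Finset.sum_congr rfl fun i _ => by ring

lemma conj_chr (k : Fin 2 → ℤ) (x : Fin 2 → ℝ) : star (chr k x) = chr (-k) x := by
  rw [chr, chr, Complex.star_def, ← Complex.exp_conj]
  congr 1
  simp only [map_mul, Complex.conj_ofReal, Complex.conj_I, map_ofNat, Fin.sum_univ_two,
    Pi.neg_apply]
  push_cast
  ring

lemma chr_mul (k l : Fin 2 → ℤ) (x : Fin 2 → ℝ) : chr k x * chr l x = chr (k + l) x := by
  rw [chr, chr, chr, ← Complex.exp_add]
  congr 1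
  simp only [Fin.sum_univ_two, Pi.add_apply]
  push_cast
  ring

lemma fc_eq_chr (f : (Fin 2 → ℝ) → ℝ) (k : Fin 2 → ℤ) :
    fc f k = ∫ x, (f x : ℂ) * chr (-k) x ∂(μT 2) := by
  rw [fc]
  congr 1
  funext x
  rw [chr]
  congr 2
  simp only [Fin.sum_univ_two, Pi.neg_apply]
  push_cast
  ring

instance : IsFiniteMeasure (μT 2) := by
  refine ⟨?_⟩
  rw [μT, box, Measure.restrict_apply_univ, volume_pi_pi]
  simp

lemma μT_eq_pi : μT 2 = Measure.pi fun _ : Fin 2 => volume.restrict (Set.Ico (0 : ℝ) 1) := by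
  rw [μT, box, volume_pi, Measure.restrict_pi_pi]

lemma integral_exp_Ico (n : ℤ) :
    ∫ x : ℝ in Set.Ico (0:ℝ) 1, Complex.exp (2 * (Real.pi : ℂ) * Complex.I * (n : ℂ) * (x : ℂ))
      = if n = 0 then 1 else 0 := by
  rw [integral_Ico_eq_integral_Ioc, ← intervalIntegral.integral_of_le zero_le_one]
  split_ifs with hn
  · simp [hn]
  · have hc : 2 * (Real.pi : ℂ) * Complex.I * (n : ℂ) ≠ 0 := by
      have : (Real.pi : ℂ) ≠ 0 := by exact_mod_cast Real.pi_ne_zero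
      have : (n : ℂ) ≠ 0 := by exact_mod_cast hn
      simp_all [Complex.I_ne_zero]
    rw [integral_exp_mul_complex hc]
    have h1 : 2 * (Real.pi : ℂ) * Complex.I * (n : ℂ) * ((1 : ℝ) : ℂ)
        = n * (2 * (Real.pi : ℂ) * Complex.I) := by push_cast; ring
    rw [h1, Complex.exp_int_mul_two_pi_mul_I]
    simp

lemma integral_chr (k : Fin 2 → ℤ) : ∫ x, chr k x ∂(μT 2) = if k = 0 then 1 else 0 := by
  simp_rw [chr_eq_prod]
  rw [μT_eq_pi, integral_fintype_prod_eq_prod (𝕜 := ℂ)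
    (f := fun i (x : ℝ) => Complex.exp (2 * (Real.pi : ℂ) * Complex.I * (k i : ℂ) * (x : ℂ)))]
  simp_rw [integral_exp_Ico]
  rw [Fin.prod_univ_two]
  by_cases h0 : k 0 = 0 <;> by_cases h1 : k 1 = 0 <;>
    simp [h0, h1, funext_iff, Fin.forall_fin_two]

lemma memLp_chr (k : Fin 2 → ℤ) : MemLp (chr k) 2 (μT 2) :=
  MemLp.of_bound (continuous_chr k).aestronglyMeasurable 1 (ae_of_all _ fun x => (norm_chr k x).le)

lemma orthonormal_chr :
    Orthonormal ℂ fun k : Fin 2 → ℤ => (memLp_chr k).toLp (chr k) := by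
  rw [orthonormal_iff_ite]
  intro k l
  rw [L2.inner_def]
  have : ∫ x, inner ℂ ((memLp_chr k).toLp (chr k) x) ((memLp_chr l).toLp (chr l) x) ∂(μT 2)
      = ∫ x, chr (l - k) x ∂(μT 2) := by
    refine integral_congr_ae ?_
    filter_upwards [(memLp_chr k).coeFn_toLp, (memLp_chr l).coeFn_toLp] with x h1 h2
    rw [h1, h2, RCLike.inner_apply, ← Complex.star_def, conj_chr, chr_mul, sub_eq_add_neg]
  rw [this, integral_chr]
  simp only [sub_eq_zero, eq_comm]

/-- Bessel's inequality on the torus, in qualitative form. -/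
lemma tsum_fc_sq_ne_top {f : (Fin 2 → ℝ) → ℝ} (hf : Measurable f) (h2 : spLp 2 f < ∞) :
    ∑' k, ‖fc f k‖ₑ ^ 2 ≠ ∞ := by
  have hfm : MemLp (fun x => (f x : ℂ)) 2 (μT 2) :=
    MemLp.ofReal (⟨hf.aestronglyMeasurable, h2⟩ : MemLp f 2 (μT 2))
  have hs := orthonormal_chr.inner_products_summable (x := hfm.toLp _)
  have hfc : ∀ k, inner ℂ ((memLp_chr k).toLp (chr k)) (hfm.toLp _) = fc f k := by
    intro k
    rw [L2.inner_def, fc_eq_chr]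
    refine integral_congr_ae ?_
    filter_upwards [(memLp_chr k).coeFn_toLp, hfm.coeFn_toLp] with x h1 h2
    rw [h1, h2, RCLike.inner_apply, ← Complex.star_def, conj_chr]
  simp_rw [hfc] at hs
  have := hs.tsum_ofReal_ne_top
  simpa [ENNReal.ofReal_pow, ofReal_norm] using this

lemma measurable_fc {ξ : ℝ → (Fin 2 → ℝ) → ℝ} (hξ : Measurable (Function.uncurry ξ))
    (k : Fin 2 → ℤ) : Measurable fun s => fc (ξ s) k := by
  simp_rw [fc_eq_chr]
  refine StronglyMeasurable.measurable ?_
  refine StronglyMeasurable.integral_prod_right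
    (f := fun s x => (ξ s x : ℂ) * chr (-k) x) ?_
  refine Measurable.stronglyMeasurable ?_
  exact (Complex.measurable_ofReal.comp hξ).mul ((continuous_chr _).measurable.comp measurable_snd)

lemma fc_neg (f : (Fin 2 → ℝ) → ℝ) (k : Fin 2 → ℤ) : fc f (-k) = star (fc f k) := by
  rw [fc_eq_chr, fc_eq_chr, Complex.star_def, ← integral_conj]
  congr 1
  funext x
  rw [map_mul, Complex.conj_ofReal, ← Complex.star_def, conj_chr]

section

/-- The Fourier coefficients of the bilinear term for a vorticity with coefficients `c`. -/
def econv (c a : (Fin 2 → ℤ) → ℂ) (k : Fin 2 → ℤ) : ℂ :=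
  (2 * (Real.pi : ℂ) * Complex.I) * ∑' l, eulerSymbol k l * c (k - l) * a l

/-- The integrand of the Duhamel term. -/
def duhInt (c y : ℝ → (Fin 2 → ℤ) → ℂ) (t : ℝ) (k : Fin 2 → ℤ) (s : ℝ) : ℂ :=
  ((Real.exp (-(4 * Real.pi ^ 2 * znorm k ^ 2) * (t - s)) : ℝ) : ℂ) * econv (c s) (y s) k

/-- The Duhamel term. -/
def duh (c y : ℝ → (Fin 2 → ℤ) → ℂ) (t : ℝ) (k : Fin 2 → ℤ) : ℂ :=
  ∫ s in Set.Ioc (0:ℝ) t, duhInt c y t k s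

/-- Homogeneous squared `Ḣ¹` seminorm (up to a factor) along a coefficient path. -/
def gradSq (c : ℝ → (Fin 2 → ℤ) → ℂ) (s : ℝ) : ℝ≥0∞ :=
  ∑' p, (ENNReal.ofReal (znorm p) * ‖c s p‖ₑ) ^ 2

/-- Coefficients of a mean-zero vorticity path with finite dissipation on `[0,T]`. -/
structure VorticityPath (T Γ : ℝ) (c : ℝ → (Fin 2 → ℤ) → ℂ) : Prop where
  meas : ∀ p, Measurable fun s => c s p
  zero : ∀ s ∈ Set.Icc (0:ℝ) T, c s 0 = 0
  sq_ne_top : ∀ s ∈ Set.Icc (0:ℝ) T, ∑' p, ‖c s p‖ₑ ^ 2 ≠ ∞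
  energy : ∫⁻ s in Set.Ioc (0:ℝ) T, gradSq c s ≤ ENNReal.ofReal Γ

/-- A bounded path in `H^σ` with continuous Fourier coefficients. -/
structure BddPath (T σ : ℝ) (y : ℝ → (Fin 2 → ℤ) → ℂ) : Prop where
  bdd : ∃ M : ℝ≥0∞, M ≠ ∞ ∧ ∀ t ∈ Set.Icc (0:ℝ) T, coefSobSq σ (y t) ≤ M
  cont : ∀ k, ContinuousOn (fun t => y t k) (Set.Icc (0:ℝ) T)

variable {T Γ σ : ℝ} {c y : ℝ → (Fin 2 → ℤ) → ℂ}

lemma VorticityPath.measurable_gradSq (hc : VorticityPath T Γ c) : Measurable (gradSq c) :=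
  Measurable.tsum fun p => ((hc.meas p).enorm.const_mul _).pow_const 2

lemma BddPath.aemeasurable (hy : BddPath T σ y) {t : ℝ} (ht : t ≤ T) (k : Fin 2 → ℤ) :
    AEMeasurable (fun s => y s k) (volume.restrict (Set.Ioc 0 t)) :=
  (((hy.cont k).aemeasurable measurableSet_Icc).mono_measure
    (Measure.restrict_mono (Set.Ioc_subset_Icc_self.trans (Set.Icc_subset_Icc_right ht)) le_rfl))

lemma BddPath.coefSobSq_ne_top (hy : BddPath T σ y) {t : ℝ} (ht : t ∈ Set.Icc 0 T) :
    coefSobSq σ (y t) ≠ ∞ := by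
  obtain ⟨M, hM, h⟩ := hy.bdd
  exact ne_top_of_le_ne_top hM (h t ht)

lemma aemeasurable_econv (hc : VorticityPath T Γ c) (hy : BddPath T σ y) {t : ℝ} (ht : t ≤ T)
    (k : Fin 2 → ℤ) :
    AEMeasurable (fun s => econv (c s) (y s) k) (volume.restrict (Set.Ioc 0 t)) :=
  (AEMeasurable.tsum fun l =>
    ((hc.meas (k - l)).aemeasurable.const_mul _).mul (hy.aemeasurable ht l)).const_mul _

lemma aestronglyMeasurable_duhInt (hc : VorticityPath T Γ c) (hy : BddPath T σ y) {t : ℝ}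
    (ht : t ≤ T) (k : Fin 2 → ℤ) :
    AEStronglyMeasurable (duhInt c y t k) (volume.restrict (Set.Ioc 0 t)) := by
  refine AEMeasurable.aestronglyMeasurable ?_
  refine AEMeasurable.mul ?_ (aemeasurable_econv hc hy ht k)
  exact Measurable.aemeasurable (by fun_prop)

lemma aemeasurable_convQ (hc : VorticityPath T Γ c) (hy : BddPath T σ y) {t : ℝ} (ht : t ≤ T)
    (k : Fin 2 → ℤ) :
    AEMeasurable (fun s => convQ σ (c s) (y s) k) (volume.restrict (Set.Ioc 0 t)) :=
  AEMeasurable.tsum fun l =>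
    ((((hc.meas (k - l)).aemeasurable.enorm.const_mul _).const_mul _).mul
      ((hy.aemeasurable ht l).enorm.const_mul _))

lemma lintegral_heat_sq_le (k : Fin 2 → ℤ) {t : ℝ} (ht : 0 ≤ t) :
    ∫⁻ s in Set.Ioc (0:ℝ) t, ENNReal.ofReal (2 * Real.pi * znorm k *
      Real.exp (-(4 * Real.pi ^ 2 * znorm k ^ 2) * (t - s))) ^ 2 ≤ 1 := by
  set L : ℝ := 4 * Real.pi ^ 2 * znorm k ^ 2 with hL
  have hL0 : 0 ≤ L := by positivity
  have hn := znorm_nonneg k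
  have hpt : ∀ s : ℝ, ENNReal.ofReal (2 * Real.pi * znorm k * Real.exp (-L * (t - s))) ^ 2
      = ENNReal.ofReal (L * Real.exp (-2 * L * (t - s))) := by
    intro s
    rw [← ENNReal.ofReal_pow (by positivity)]
    congr 1
    rw [mul_pow, ← Real.exp_nat_mul]
    have h2 : ((2 : ℕ) : ℝ) * (-L * (t - s)) = -2 * L * (t - s) := by push_cast; ring
    have h3 : (2 * Real.pi * znorm k) ^ 2 = L := by rw [hL]; ring
    rw [h2, h3]
  simp_rw [hpt]
  have hcont : Continuous fun s : ℝ => L * Real.exp (-2 * L * (t - s)) := by fun_prop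
  rw [← ofReal_integral_eq_lintegral_ofReal
    ((hcont.integrableOn_Icc (a := 0) (b := t)).mono_set Set.Ioc_subset_Icc_self)
    (ae_of_all _ fun s => by positivity), ← intervalIntegral.integral_of_le ht]
  have hd : ∀ s ∈ Set.uIcc 0 t, HasDerivAt (fun s : ℝ => Real.exp (-2 * L * (t - s)) / 2)
      (L * Real.exp (-2 * L * (t - s))) s := by
    intro s _
    have h1 : HasDerivAt (fun s : ℝ => -2 * L * (t - s)) (-2 * L * (-1)) s :=
      ((hasDerivAt_id s).const_sub t).const_mul _
    exact (h1.exp.div_const 2).congr_deriv (by ring)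
  rw [intervalIntegral.integral_eq_sub_of_hasDerivAt hd (hcont.intervalIntegrable _ _)]
  refine ENNReal.ofReal_le_one.2 ?_
  have := Real.exp_pos (-2 * L * (t - 0))
  simp only [sub_self, mul_zero, Real.exp_zero]
  linarith

lemma wt_mul_enorm_econv_le (h0 : σ ≤ 0) (h1 : -1 ≤ σ) {c a : (Fin 2 → ℤ) → ℂ} (hc : c 0 = 0)
    (k : Fin 2 → ℤ) :
    ENNReal.ofReal (wt σ k) * ‖econv c a k‖ₑ
      ≤ ENNReal.ofReal (2 * Real.pi * znorm k) * convQ σ c a k := by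
  have hpi : ‖2 * (Real.pi : ℂ) * Complex.I‖ₑ = ENNReal.ofReal (2 * Real.pi) := by
    rw [← ofReal_norm]
    congr 1
    simp [abs_of_pos Real.pi_pos]
  have hb : ‖∑' l, eulerSymbol k l * c (k - l) * a l‖ₑ
      ≤ ∑' l, ‖eulerSymbol k l * c (k - l) * a l‖ₑ := enorm_tsum_le_tsum_enorm
  rw [econv, enorm_mul, hpi, ENNReal.ofReal_mul (q := znorm k) (by positivity)]
  calc ENNReal.ofReal (wt σ k) * (ENNReal.ofReal (2 * Real.pi) *
        ‖∑' l, eulerSymbol k l * c (k - l) * a l‖ₑ)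
      = ENNReal.ofReal (2 * Real.pi) * (ENNReal.ofReal (wt σ k) *
        ‖∑' l, eulerSymbol k l * c (k - l) * a l‖ₑ) := by ring
    _ ≤ ENNReal.ofReal (2 * Real.pi) * (ENNReal.ofReal (znorm k) * convQ σ c a k) :=
        mul_le_mul_right ((mul_le_mul_right hb _).trans (wt_mul_tsum_symbol_le h0 h1 hc a k)) _
    _ = _ := by ring

lemma lintegral_duhInt_sq_le (h0 : σ ≤ 0) (h1 : -1 ≤ σ) (hc : VorticityPath T Γ c)
    (hy : BddPath T σ y) {t : ℝ} (ht : t ∈ Set.Icc 0 T) (k : Fin 2 → ℤ) :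
    (ENNReal.ofReal (wt σ k) * ∫⁻ s in Set.Ioc (0:ℝ) t, ‖duhInt c y t k s‖ₑ) ^ 2
      ≤ ∫⁻ s in Set.Ioc (0:ℝ) t, convQ σ (c s) (y s) k ^ 2 := by
  set h : ℝ → ℝ≥0∞ := fun s => ENNReal.ofReal (2 * Real.pi * znorm k *
      Real.exp (-(4 * Real.pi ^ 2 * znorm k ^ 2) * (t - s))) with hh
  have hhm : Measurable h := by rw [hh]; fun_prop
  have hle : ENNReal.ofReal (wt σ k) * ∫⁻ s in Set.Ioc (0:ℝ) t, ‖duhInt c y t k s‖ₑ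
      ≤ ∫⁻ s in Set.Ioc (0:ℝ) t, h s * convQ σ (c s) (y s) k := by
    rw [← lintegral_const_mul' _ _ ENNReal.ofReal_ne_top]
    refine setLIntegral_mono' measurableSet_Ioc fun s hs => ?_
    have hn := znorm_nonneg k
    have he : ‖((Real.exp (-(4 * Real.pi ^ 2 * znorm k ^ 2) * (t - s)) : ℝ) : ℂ)‖ₑ
        = ENNReal.ofReal (Real.exp (-(4 * Real.pi ^ 2 * znorm k ^ 2) * (t - s))) := by
      rw [← ofReal_norm, Complex.norm_real, Real.norm_of_nonneg (Real.exp_pos _).le]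
    rw [duhInt, enorm_mul, he, hh]
    simp only
    rw [ENNReal.ofReal_mul (by positivity)]
    have := wt_mul_enorm_econv_le h0 h1 (a := y s) (hc.zero s ⟨hs.1.le, hs.2.trans ht.2⟩) k
    calc _ = ENNReal.ofReal (Real.exp (-(4 * Real.pi ^ 2 * znorm k ^ 2) * (t - s))) *
          (ENNReal.ofReal (wt σ k) * ‖econv (c s) (y s) k‖ₑ) := by ring
      _ ≤ ENNReal.ofReal (Real.exp (-(4 * Real.pi ^ 2 * znorm k ^ 2) * (t - s))) *
          (ENNReal.ofReal (2 * Real.pi * znorm k) * convQ σ (c s) (y s) k) := by gcongr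
      _ = _ := by ring
  calc _ ≤ (∫⁻ s in Set.Ioc (0:ℝ) t, h s * convQ σ (c s) (y s) k) ^ 2 := by gcongr
    _ ≤ _ := lintegral_mul_sq_le _ hhm.aemeasurable (aemeasurable_convQ hc hy ht.2 k)
    _ ≤ 1 * ∫⁻ s in Set.Ioc (0:ℝ) t, convQ σ (c s) (y s) k ^ 2 := by
        gcongr
        exact lintegral_heat_sq_le k ht.1
    _ = _ := one_mul _

/-- The constant of the smoothing estimate. -/
def kap : ℝ := 2560 * rqSum

lemma kap_nonneg : 0 ≤ kap := by
  have : 0 ≤ rqSum := tsum_nonneg fun k => by positivity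
  unfold kap; positivity

lemma tsum_lintegral_convQ_le (hc : VorticityPath T Γ c)
    (hy : BddPath T σ y) {t : ℝ} (ht : t ≤ T) :
    ∑' k, ∫⁻ s in Set.Ioc (0:ℝ) t, convQ σ (c s) (y s) k ^ 2
      ≤ ENNReal.ofReal kap * ∫⁻ s in Set.Ioc (0:ℝ) t, gradSq c s * coefSobSq σ (y s) := by
  rw [← lintegral_tsum fun k => (aemeasurable_convQ hc hy ht k).pow_const 2,
    ← lintegral_const_mul' _ _ ENNReal.ofReal_ne_top]
  exact lintegral_mono fun s => tsum_convQ_sq_le σ (c s) (y s)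

lemma lintegral_gradSq_mul_ne_top (hc : VorticityPath T Γ c) (hy : BddPath T σ y) {t : ℝ}
    (ht : t ≤ T) :
    ∫⁻ s in Set.Ioc (0:ℝ) t, gradSq c s * coefSobSq σ (y s) ≠ ∞ := by
  obtain ⟨M, hM, h⟩ := hy.bdd
  refine ne_top_of_le_ne_top (b := (∫⁻ s in Set.Ioc (0:ℝ) T, gradSq c s) * M)
    (ENNReal.mul_ne_top (ne_top_of_le_ne_top ENNReal.ofReal_ne_top hc.energy) hM) ?_
  rw [← lintegral_mul_const _ hc.measurable_gradSq]
  refine (setLIntegral_mono' measurableSet_Ioc fun s hs => ?_).trans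
    (lintegral_mono_set (Set.Ioc_subset_Ioc_right ht))
  gcongr
  exact h s ⟨hs.1.le, hs.2.trans ht⟩

lemma tsum_lintegral_convQ_ne_top (hc : VorticityPath T Γ c) (hy : BddPath T σ y) {t : ℝ}
    (ht : t ≤ T) :
    ∑' k, ∫⁻ s in Set.Ioc (0:ℝ) t, convQ σ (c s) (y s) k ^ 2 ≠ ∞ :=
  ne_top_of_le_ne_top (ENNReal.mul_ne_top ENNReal.ofReal_ne_top
    (lintegral_gradSq_mul_ne_top hc hy ht)) (tsum_lintegral_convQ_le hc hy ht)

lemma integrableOn_duhInt (h0 : σ ≤ 0) (h1 : -1 ≤ σ) (hc : VorticityPath T Γ c)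
    (hy : BddPath T σ y) {t : ℝ} (ht : t ∈ Set.Icc 0 T) (k : Fin 2 → ℤ) :
    IntegrableOn (duhInt c y t k) (Set.Ioc 0 t) := by
  refine ⟨aestronglyMeasurable_duhInt hc hy ht.2 k, ?_⟩
  have hb := lintegral_duhInt_sq_le h0 h1 hc hy ht k
  have hfin := ENNReal.ne_top_of_tsum_ne_top (tsum_lintegral_convQ_ne_top hc hy ht.2) k
  have h3 := ne_top_of_le_ne_top hfin hb
  rw [Ne, ENNReal.pow_eq_top_iff] at h3
  have h4 : ENNReal.ofReal (wt σ k) * ∫⁻ s in Set.Ioc (0:ℝ) t, ‖duhInt c y t k s‖ₑ ≠ ∞ :=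
    fun h => h3 ⟨h, two_ne_zero⟩
  rw [HasFiniteIntegral, lt_top_iff_ne_top]
  intro h
  rw [h, ENNReal.mul_top (by simpa using wt_pos σ k)] at h4
  exact h4 rfl

lemma wt_mul_duh_sq_le (h0 : σ ≤ 0) (h1 : -1 ≤ σ) (hc : VorticityPath T Γ c)
    (hy : BddPath T σ y) {t : ℝ} (ht : t ∈ Set.Icc 0 T) (k : Fin 2 → ℤ) :
    (ENNReal.ofReal (wt σ k) * ‖duh c y t k‖ₑ) ^ 2
      ≤ ∫⁻ s in Set.Ioc (0:ℝ) t, convQ σ (c s) (y s) k ^ 2 := by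
  refine le_trans ?_ (lintegral_duhInt_sq_le h0 h1 hc hy ht k)
  gcongr
  exact enorm_integral_le_lintegral_enorm _

/-- The smoothing estimate for the Duhamel term. -/
lemma coefSobSq_duh_le (h0 : σ ≤ 0) (h1 : -1 ≤ σ) (hc : VorticityPath T Γ c)
    (hy : BddPath T σ y) {t : ℝ} (ht : t ∈ Set.Icc 0 T) :
    coefSobSq σ (duh c y t)
      ≤ ENNReal.ofReal kap * ∫⁻ s in Set.Ioc (0:ℝ) t, gradSq c s * coefSobSq σ (y s) := by
  rw [coefSobSq_eq]
  exact (ENNReal.tsum_le_tsum fun k => wt_mul_duh_sq_le h0 h1 hc hy ht k).trans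
    (tsum_lintegral_convQ_le hc hy ht.2)

lemma continuousOn_duh (hT : 0 ≤ T) (h0 : σ ≤ 0) (h1 : -1 ≤ σ) (hc : VorticityPath T Γ c)
    (hy : BddPath T σ y) (k : Fin 2 → ℤ) :
    ContinuousOn (fun t => duh c y t k) (Set.Icc 0 T) := by
  set L : ℝ := 4 * Real.pi ^ 2 * znorm k ^ 2 with hL
  set g : ℝ → ℂ := fun s => ((Real.exp (L * s) : ℝ) : ℂ) * econv (c s) (y s) k with hg
  have hfac : ∀ t s, duhInt c y t k s = ((Real.exp (-L * t) : ℝ) : ℂ) * g s := by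
    intro t s
    rw [duhInt, hg, ← mul_assoc, ← Complex.ofReal_mul, ← Real.exp_add]
    congr 3
    ring
  have hgi : IntegrableOn g (Set.Icc 0 T) := by
    rw [integrableOn_Icc_iff_integrableOn_Ioc]
    have h := (integrableOn_duhInt h0 h1 hc hy (Set.right_mem_Icc.2 hT) k).const_mul
      ((Real.exp (L * T) : ℝ) : ℂ)
    refine h.congr (ae_of_all _ fun s => ?_)
    simp only
    rw [hfac, ← mul_assoc, ← Complex.ofReal_mul, ← Real.exp_add]
    simp
  have hd : (fun t => duh c y t k)
      = fun t => ((Real.exp (-L * t) : ℝ) : ℂ) * ∫ s in Set.Ioc 0 t, g s := by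
    funext t
    rw [duh, ← integral_const_mul]
    simp_rw [hfac]
  rw [hd]
  refine ContinuousOn.mul (Continuous.continuousOn (by fun_prop)) ?_
  exact intervalIntegral.continuousOn_primitive hgi

end

section

variable {T Γ σ : ℝ} {c y y₁ y₂ : ℝ → (Fin 2 → ℤ) → ℂ}

lemma econv_add_smul {c a₁ a₂ : (Fin 2 → ℤ) → ℂ} {k : Fin 2 → ℤ}
    (h₁ : Summable fun l => ‖eulerSymbol k l * c (k - l) * a₁ l‖)
    (h₂ : Summable fun l => ‖eulerSymbol k l * c (k - l) * a₂ l‖) (a b : ℂ) :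
    econv c (fun l => a * a₁ l + b * a₂ l) k = a * econv c a₁ k + b * econv c a₂ k := by
  have hs : ∀ l, eulerSymbol k l * c (k - l) * (a * a₁ l + b * a₂ l)
      = a * (eulerSymbol k l * c (k - l) * a₁ l) + b * (eulerSymbol k l * c (k - l) * a₂ l) :=
    fun l => by ring
  simp_rw [econv, hs]
  rw [(h₁.of_norm.mul_left a).tsum_add (h₂.of_norm.mul_left b), tsum_mul_left, tsum_mul_left]
  ring

lemma duhInt_add_smul {t s : ℝ} {k : Fin 2 → ℤ}
    (h₁ : Summable fun l => ‖eulerSymbol k l * c s (k - l) * y₁ s l‖)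
    (h₂ : Summable fun l => ‖eulerSymbol k l * c s (k - l) * y₂ s l‖) (a b : ℂ) :
    duhInt c (fun s l => a * y₁ s l + b * y₂ s l) t k s
      = a * duhInt c y₁ t k s + b * duhInt c y₂ t k s := by
  simp only [duhInt]
  rw [econv_add_smul h₁ h₂]
  ring

lemma integrableOn_duhInt_add_smul {t : ℝ} {k : Fin 2 → ℤ}
    (h₁ : ∀ s ∈ Set.Ioc 0 t, Summable fun l => ‖eulerSymbol k l * c s (k - l) * y₁ s l‖)
    (h₂ : ∀ s ∈ Set.Ioc 0 t, Summable fun l => ‖eulerSymbol k l * c s (k - l) * y₂ s l‖)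
    (i₁ : IntegrableOn (duhInt c y₁ t k) (Set.Ioc 0 t))
    (i₂ : IntegrableOn (duhInt c y₂ t k) (Set.Ioc 0 t)) (a b : ℂ) :
    IntegrableOn (duhInt c (fun s l => a * y₁ s l + b * y₂ s l) t k) (Set.Ioc 0 t) := by
  have h := (i₁.const_mul a).add (i₂.const_mul b)
  refine h.congr ?_
  filter_upwards [ae_restrict_mem measurableSet_Ioc] with s hs
  exact (duhInt_add_smul (h₁ s hs) (h₂ s hs) a b).symm

lemma duh_add_smul {t : ℝ} {k : Fin 2 → ℤ}
    (h₁ : ∀ s ∈ Set.Ioc 0 t, Summable fun l => ‖eulerSymbol k l * c s (k - l) * y₁ s l‖)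
    (h₂ : ∀ s ∈ Set.Ioc 0 t, Summable fun l => ‖eulerSymbol k l * c s (k - l) * y₂ s l‖)
    (i₁ : IntegrableOn (duhInt c y₁ t k) (Set.Ioc 0 t))
    (i₂ : IntegrableOn (duhInt c y₂ t k) (Set.Ioc 0 t)) (a b : ℂ) :
    duh c (fun s l => a * y₁ s l + b * y₂ s l) t k = a * duh c y₁ t k + b * duh c y₂ t k := by
  rw [duh, setIntegral_congr_fun measurableSet_Ioc
    fun s hs => duhInt_add_smul (h₁ s hs) (h₂ s hs) a b,
    integral_add (i₁.const_mul a) (i₂.const_mul b), integral_const_mul, integral_const_mul]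
  rfl

lemma BddPath.summable (h1 : -1 ≤ σ) (hc : VorticityPath T Γ c) (hy : BddPath T σ y) {s : ℝ}
    (hs : s ∈ Set.Icc 0 T) (k : Fin 2 → ℤ) :
    Summable fun l => ‖eulerSymbol k l * c s (k - l) * y s l‖ :=
  summable_symbol h1 (hc.zero s hs) (hc.sq_ne_top s hs) (hy.coefSobSq_ne_top hs) k

lemma duh_sub (h0 : σ ≤ 0) (h1 : -1 ≤ σ) (hc : VorticityPath T Γ c) (hy₁ : BddPath T σ y₁)
    (hy₂ : BddPath T σ y₂) {t : ℝ} (ht : t ∈ Set.Icc 0 T) (k : Fin 2 → ℤ) :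
    duh c (fun s l => y₁ s l - y₂ s l) t k = duh c y₁ t k - duh c y₂ t k := by
  have hs : ∀ s ∈ Set.Ioc 0 t, s ∈ Set.Icc 0 T := fun s hs => ⟨hs.1.le, hs.2.trans ht.2⟩
  have h := duh_add_smul (fun s h => hy₁.summable h1 hc (hs s h) k)
    (fun s h => hy₂.summable h1 hc (hs s h) k) (integrableOn_duhInt h0 h1 hc hy₁ ht k)
    (integrableOn_duhInt h0 h1 hc hy₂ ht k) 1 (-1)
  simpa [← sub_eq_add_neg] using h

lemma coefSobNorm_sq (s : ℝ) (a : (Fin 2 → ℤ) → ℂ) : coefSobNorm s a ^ 2 = coefSobSq s a := by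
  rw [coefSobNorm, ← ENNReal.rpow_natCast, ← ENNReal.rpow_mul]
  norm_num

lemma coefSobNorm_eq_sqrt_of_sq {s : ℝ} {a : (Fin 2 → ℤ) → ℂ} {x : ℝ≥0∞}
    (h : x ^ 2 = coefSobSq s a) : x = coefSobNorm s a := by
  rw [← coefSobNorm_sq] at h
  exact (ENNReal.pow_right_strictMono two_ne_zero).injective h

/-- A path in `C⁰([0,T]; H^σ)`. -/
structure SobPath (T σ : ℝ) (y : ℝ → (Fin 2 → ℤ) → ℂ) : Prop where
  bdd : ∃ M : ℝ≥0∞, M ≠ ∞ ∧ ∀ t ∈ Set.Icc (0:ℝ) T, coefSobSq σ (y t) ≤ M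
  tendsto : ∀ t ∈ Set.Icc (0:ℝ) T, Tendsto (fun t' => coefSobNorm σ (fun k => y t' k - y t k))
    (nhdsWithin t (Set.Icc 0 T)) (nhds 0)

lemma contCoefSob_iff : ContCoefSob T σ y ↔ ∀ t ∈ Set.Icc (0:ℝ) T,
    Tendsto (fun t' => coefSobNorm σ (fun k => y t' k - y t k))
      (nhdsWithin t (Set.Icc 0 T)) (nhds 0) := by
  refine forall₂_congr fun t ht => ?_
  rw [ENNReal.tendsto_nhds_zero]
  constructor
  · intro h ε hε
    obtain ⟨r, hr, hr'⟩ : ∃ r : ℝ, 0 < r ∧ ENNReal.ofReal r ≤ ε := by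
      rcases eq_or_ne ε ∞ with rfl | hε'
      · exact ⟨1, one_pos, le_top⟩
      · exact ⟨ε.toReal, ENNReal.toReal_pos hε.ne' hε', ENNReal.ofReal_toReal_le⟩
    obtain ⟨δ, hδ, h'⟩ := h r hr
    rw [eventually_nhdsWithin_iff]
    filter_upwards [Metric.ball_mem_nhds t hδ] with t' h1 h2
    exact (h' t' h2 (by simpa [Real.dist_eq] using h1)).le.trans hr'
  · intro h ε hε
    have := h (ENNReal.ofReal (ε / 2)) (ENNReal.ofReal_pos.2 (half_pos hε))
    rw [eventually_nhdsWithin_iff, Metric.eventually_nhds_iff] at this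
    obtain ⟨δ, hδ, h'⟩ := this
    refine ⟨δ, hδ, fun t' h1 h2 => (h' (by simpa [Real.dist_eq] using h2) h1).trans_lt ?_⟩
    exact (ENNReal.ofReal_lt_ofReal_iff hε).2 (half_lt_self hε)

lemma coefSobSq_le_supCoefSob {t : ℝ} (ht : t ∈ Set.Icc 0 T) :
    coefSobSq σ (y t) ≤ supCoefSob T σ y ^ 2 := by
  rw [← coefSobNorm_sq]
  gcongr
  exact le_iSup₂ (f := fun t (_ : t ∈ Set.Icc (0:ℝ) T) => coefSobNorm σ (y t)) t ht

lemma SobPath.of_contCoefSob (h : ContCoefSob T σ y) (hs : supCoefSob T σ y < ∞) :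
    SobPath T σ y :=
  ⟨⟨supCoefSob T σ y ^ 2, ENNReal.pow_ne_top hs.ne, fun _ ht => coefSobSq_le_supCoefSob ht⟩,
    contCoefSob_iff.1 h⟩

lemma supCoefSob_le {x : ℝ≥0∞} (h : ∀ t ∈ Set.Icc (0:ℝ) T, coefSobSq σ (y t) ≤ x ^ 2) :
    supCoefSob T σ y ≤ x := by
  refine iSup₂_le fun t ht => ?_
  have := h t ht
  rw [← coefSobNorm_sq] at this
  exact (ENNReal.pow_le_pow_left_iff two_ne_zero).1 this

lemma SobPath.supCoefSob_lt_top (h : SobPath T σ y) : supCoefSob T σ y < ∞ := by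
  obtain ⟨M, hM, h⟩ := h.bdd
  refine lt_of_le_of_lt (supCoefSob_le (x := M ^ (1 / 2 : ℝ)) fun t ht => ?_)
    (ENNReal.rpow_lt_top_of_nonneg (by norm_num) hM)
  rw [← ENNReal.rpow_natCast, ← ENNReal.rpow_mul]
  simpa using h t ht

lemma wt_mul_enorm_le (s : ℝ) (a : (Fin 2 → ℤ) → ℂ) (k : Fin 2 → ℤ) :
    ENNReal.ofReal (wt s k) * ‖a k‖ₑ ≤ coefSobNorm s a := by
  rw [← ENNReal.pow_le_pow_left_iff two_ne_zero, coefSobNorm_sq, coefSobSq_eq]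
  exact ENNReal.le_tsum (f := fun k => (ENNReal.ofReal (wt s k) * ‖a k‖ₑ) ^ 2) k

lemma SobPath.bddPath (h : SobPath T σ y) : BddPath T σ y := by
  refine ⟨h.bdd, fun k t ht => ?_⟩
  have h1 := h.tendsto t ht
  have hw : ENNReal.ofReal (wt σ k) ≠ 0 := by simpa using wt_pos σ k
  have h2 : Tendsto (fun t' => ENNReal.ofReal (wt σ k) * ‖y t' k - y t k‖ₑ)
      (nhdsWithin t (Set.Icc 0 T)) (nhds 0) :=
    tendsto_of_tendsto_of_tendsto_of_le_of_le tendsto_const_nhds h1 (fun _ => zero_le)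
      fun t' => wt_mul_enorm_le σ (fun k => y t' k - y t k) k
  have h3 := ENNReal.Tendsto.const_mul (a := (ENNReal.ofReal (wt σ k))⁻¹) h2
    (Or.inr (ENNReal.inv_ne_top.2 hw))
  simp only [← mul_assoc, ENNReal.inv_mul_cancel hw ENNReal.ofReal_ne_top, one_mul, mul_zero] at h3
  rw [ContinuousWithinAt, tendsto_iff_edist_tendsto_0]
  simpa only [edist_eq_enorm_sub] using h3

lemma coefSobSq_add_le (s : ℝ) (a b : (Fin 2 → ℤ) → ℂ) :
    coefSobSq s (fun k => a k + b k) ≤ 2 * (coefSobSq s a + coefSobSq s b) := by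
  simp only [coefSobSq_eq]
  rw [← ENNReal.tsum_add, ← ENNReal.tsum_mul_left]
  refine ENNReal.tsum_le_tsum fun k => ?_
  refine le_trans ?_ (add_sq_le_two_mul _ _)
  rw [← mul_add]
  gcongr
  exact enorm_add_le _ _

lemma coefSobSq_neg (s : ℝ) (a : (Fin 2 → ℤ) → ℂ) :
    coefSobSq s (fun k => -a k) = coefSobSq s a := by
  simp only [coefSobSq_eq, enorm_neg]

lemma tendsto_coefSobNorm_iff {ι : Type*} {l : Filter ι} {f : ι → (Fin 2 → ℤ) → ℂ} :
    Tendsto (fun i => coefSobNorm σ (f i)) l (nhds 0)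
      ↔ Tendsto (fun i => coefSobSq σ (f i)) l (nhds 0) := by
  constructor
  · intro h
    have := ((ENNReal.continuous_pow 2).tendsto 0).comp h
    simpa only [Function.comp_def, coefSobNorm_sq, ne_eq, OfNat.ofNat_ne_zero,
      not_false_eq_true, zero_pow] using this
  · intro h
    have := ((ENNReal.continuous_rpow_const (y := (1 / 2 : ℝ))).tendsto 0).comp h
    rwa [ENNReal.zero_rpow_of_pos (by norm_num)] at this

lemma SobPath.neg (h : SobPath T σ y) : SobPath T σ (fun t k => -y t k) := by
  refine ⟨?_, fun t ht => ?_⟩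
  · simpa only [coefSobSq_neg] using h.bdd
  · refine (h.tendsto t ht).congr fun t' => ?_
    rw [coefSobNorm, coefSobNorm, ← coefSobSq_neg]
    congr 2
    funext k
    ring

lemma SobPath.add (h₁ : SobPath T σ y₁) (h₂ : SobPath T σ y₂) :
    SobPath T σ (fun t k => y₁ t k + y₂ t k) := by
  refine ⟨?_, fun t ht => ?_⟩
  · obtain ⟨M₁, hM₁, h₁⟩ := h₁.bdd
    obtain ⟨M₂, hM₂, h₂⟩ := h₂.bdd
    refine ⟨2 * (M₁ + M₂), ENNReal.mul_ne_top (by norm_num) (ENNReal.add_ne_top.2 ⟨hM₁, hM₂⟩),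
      fun t ht => (coefSobSq_add_le _ _ _).trans ?_⟩
    gcongr
    exacts [h₁ t ht, h₂ t ht]
  · rw [tendsto_coefSobNorm_iff]
    have t₁ := tendsto_coefSobNorm_iff.1 (h₁.tendsto t ht)
    have t₂ := tendsto_coefSobNorm_iff.1 (h₂.tendsto t ht)
    have t₃ := ENNReal.Tendsto.const_mul (a := 2) (t₁.add t₂) (Or.inr (by norm_num))
    rw [add_zero, mul_zero] at t₃
    refine tendsto_of_tendsto_of_tendsto_of_le_of_le tendsto_const_nhds t₃ (fun _ => zero_le)
      fun t' => ?_
    refine le_trans (le_of_eq ?_) (coefSobSq_add_le _ _ _)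
    congr 1
    funext k
    ring

lemma sobPath_duh (hT : 0 ≤ T) (h0 : σ ≤ 0) (h1 : -1 ≤ σ) (hc : VorticityPath T Γ c)
    (hy : BddPath T σ y) : SobPath T σ (duh c y) := by
  set b : (Fin 2 → ℤ) → ℝ≥0∞ := fun k => ∫⁻ s in Set.Ioc (0:ℝ) T, convQ σ (c s) (y s) k ^ 2
    with hb
  have hbsum : ∑' k, b k ≠ ∞ := tsum_lintegral_convQ_ne_top hc hy le_rfl
  have hle : ∀ t ∈ Set.Icc 0 T, ∀ k, (ENNReal.ofReal (wt σ k) * ‖duh c y t k‖ₑ) ^ 2 ≤ b k :=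
    fun t ht k => (wt_mul_duh_sq_le h0 h1 hc hy ht k).trans
      (lintegral_mono_set (Set.Ioc_subset_Ioc_right ht.2))
  refine ⟨⟨∑' k, b k, hbsum, fun t ht => ?_⟩, fun t ht => ?_⟩
  · rw [coefSobSq_eq]
    exact ENNReal.tsum_le_tsum (hle t ht)
  · rw [tendsto_coefSobNorm_iff]
    let _ : MeasurableSpace (Fin 2 → ℤ) := ⊤
    have key := tendsto_lintegral_filter_of_dominated_convergence
      (μ := (Measure.count : Measure (Fin 2 → ℤ))) (l := nhdsWithin t (Set.Icc 0 T))
      (F := fun t' k => (ENNReal.ofReal (wt σ k) * ‖duh c y t' k - duh c y t k‖ₑ) ^ 2)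
      (f := fun _ => 0) (fun k => 2 * (b k + b k))
      (Eventually.of_forall fun _ => measurable_from_top) ?_ ?_ ?_
    · simpa only [lintegral_count, tsum_zero, ← coefSobSq_eq] using key
    · filter_upwards [self_mem_nhdsWithin] with t' ht'
      refine ae_of_all _ fun k => ?_
      calc _ ≤ (ENNReal.ofReal (wt σ k) * ‖duh c y t' k‖ₑ
              + ENNReal.ofReal (wt σ k) * ‖duh c y t k‖ₑ) ^ 2 := by
            rw [← mul_add]
            gcongr
            exact enorm_sub_le
        _ ≤ _ := (add_sq_le_two_mul _ _).trans
            (mul_le_mul_right (add_le_add (hle t' ht' k) (hle t ht k)) _)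
    · rw [lintegral_count, ENNReal.tsum_mul_left, ENNReal.tsum_add]
      exact ENNReal.mul_ne_top (by norm_num) (ENNReal.add_ne_top.2 ⟨hbsum, hbsum⟩)
    · refine ae_of_all _ fun k => ?_
      have h2 : Tendsto (fun t' => ‖duh c y t' k - duh c y t k‖ₑ)
          (nhdsWithin t (Set.Icc 0 T)) (nhds 0) := by
        have := tendsto_iff_edist_tendsto_0.1 (continuousOn_duh hT h0 h1 hc hy k t ht)
        simpa only [edist_eq_enorm_sub] using this
      have h3 := ENNReal.Tendsto.const_mul (a := ENNReal.ofReal (wt σ k)) h2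
        (Or.inr ENNReal.ofReal_ne_top)
      have h4 := ((ENNReal.continuous_pow 2).tendsto _).comp h3
      simpa [Function.comp_def] using h4

end

section

variable {T Γ σ : ℝ} {c y y₁ y₂ z : ℝ → (Fin 2 → ℤ) → ℂ}

/-- Square-summable families indexed by the frequency lattice. -/
abbrev ellTwo : Type := lp (fun _ : Fin 2 → ℤ => ℂ) 2

lemma enorm_sq_ellTwo (u : ellTwo) : ‖u‖ₑ ^ 2 = ∑' k, ‖u k‖ₑ ^ 2 := by
  have h2 : 0 < (2 : ℝ≥0∞).toReal := by norm_num
  have h := lp.norm_rpow_eq_tsum h2 u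
  have hs := (memℓp_gen_iff h2).1 (lp.memℓp u)
  simp only [ENNReal.toReal_ofNat, Real.rpow_two] at h hs
  rw [← ofReal_norm, ← ENNReal.ofReal_pow (norm_nonneg _), h,
    ENNReal.ofReal_tsum_of_nonneg (fun _ => by positivity) hs]
  refine tsum_congr fun k => ?_
  rw [ENNReal.ofReal_pow (norm_nonneg _), ofReal_norm]

lemma memℓp_wt_mul {a : (Fin 2 → ℤ) → ℂ} (h : coefSobSq σ a ≠ ∞) :
    Memℓp (fun k => (wt σ k : ℂ) * a k) 2 := by
  refine (memℓp_gen_iff (by norm_num)).2 ?_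
  rw [coefSobSq_eq] at h
  have hs := ENNReal.summable_toReal h
  refine hs.congr fun k => ?_
  simp [abs_of_pos (wt_pos σ k), (wt_pos σ k).le]

/-- The isometry from `H^σ` to `ℓ²`. -/
def toEllTwo (σ : ℝ) (a : (Fin 2 → ℤ) → ℂ) (h : coefSobSq σ a ≠ ∞) : ellTwo :=
  ⟨fun k => (wt σ k : ℂ) * a k, memℓp_wt_mul h⟩

lemma toEllTwo_apply {a : (Fin 2 → ℤ) → ℂ} (h : coefSobSq σ a ≠ ∞) (k : Fin 2 → ℤ) :
    toEllTwo σ a h k = (wt σ k : ℂ) * a k := rfl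

/-- The isometry from `ℓ²` to `H^σ`. -/
def ofEllTwo (σ : ℝ) (u : ellTwo) (k : Fin 2 → ℤ) : ℂ := (wt σ k : ℂ)⁻¹ * u k

lemma wt_ne_zero (σ : ℝ) (k : Fin 2 → ℤ) : (wt σ k : ℂ) ≠ 0 := by
  exact_mod_cast (wt_pos σ k).ne'

lemma enorm_wt (σ : ℝ) (k : Fin 2 → ℤ) : ‖(wt σ k : ℂ)‖ₑ = ENNReal.ofReal (wt σ k) := by
  rw [← ofReal_norm, Complex.norm_real, Real.norm_of_nonneg (wt_pos σ k).le]

lemma ofEllTwo_toEllTwo {a : (Fin 2 → ℤ) → ℂ} (h : coefSobSq σ a ≠ ∞) :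
    ofEllTwo σ (toEllTwo σ a h) = a := by
  funext k
  rw [ofEllTwo, toEllTwo_apply, inv_mul_cancel_left₀ (wt_ne_zero σ k)]

lemma coefSobSq_ofEllTwo (u : ellTwo) : coefSobSq σ (ofEllTwo σ u) = ‖u‖ₑ ^ 2 := by
  rw [coefSobSq_eq, enorm_sq_ellTwo]
  refine tsum_congr fun k => ?_
  rw [← enorm_wt, ← enorm_mul, ofEllTwo, mul_inv_cancel_left₀ (wt_ne_zero σ k)]

lemma ofEllTwo_sub (u v : ellTwo) (k : Fin 2 → ℤ) :
    ofEllTwo σ (u - v) k = ofEllTwo σ u k - ofEllTwo σ v k := by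
  simp [ofEllTwo, mul_sub]

lemma coefSobNorm_ofEllTwo (u : ellTwo) : coefSobNorm σ (ofEllTwo σ u) = ‖u‖ₑ :=
  (coefSobNorm_eq_sqrt_of_sq (coefSobSq_ofEllTwo u).symm).symm

/-- The coefficient path of a continuous `ℓ²`-valued path, extended constantly in time. -/
def pathOf (hT : 0 ≤ T) (σ : ℝ) (u : C(Set.Icc (0:ℝ) T, ellTwo)) (t : ℝ) : (Fin 2 → ℤ) → ℂ :=
  ofEllTwo σ (u (Set.projIcc 0 T hT t))

lemma pathOf_sub (hT : 0 ≤ T) (u v : C(Set.Icc (0:ℝ) T, ellTwo)) :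
    pathOf hT σ (u - v) = fun t k => pathOf hT σ u t k - pathOf hT σ v t k := by
  funext t k
  exact ofEllTwo_sub _ _ _

lemma sobPath_pathOf (hT : 0 ≤ T) (u : C(Set.Icc (0:ℝ) T, ellTwo)) :
    SobPath T σ (pathOf hT σ u) := by
  refine ⟨⟨‖u‖ₑ ^ 2, ENNReal.pow_ne_top enorm_ne_top, fun t _ => ?_⟩, fun t _ => ?_⟩
  · rw [pathOf, coefSobSq_ofEllTwo]
    gcongr
    exact enorm_le_iff_norm_le.2 (u.norm_coe_le_norm _)
  · have hcont : Continuous fun t => u (Set.projIcc 0 T hT t) :=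
      u.continuous.comp continuous_projIcc
    have h := tendsto_iff_edist_tendsto_0.1 (hcont.continuousWithinAt (s := Set.Icc 0 T) (x := t))
    refine h.congr fun t' => ?_
    rw [edist_eq_enorm_sub, ← coefSobNorm_ofEllTwo (σ := σ)]
    congr 1
    funext k
    exact ofEllTwo_sub _ _ _

/-- The continuous `ℓ²`-valued path of a path in `C⁰([0,T]; H^σ)`. -/
def ofPath (y : ℝ → (Fin 2 → ℤ) → ℂ) (hy : SobPath T σ y) : C(Set.Icc (0:ℝ) T, ellTwo) where
  toFun t := toEllTwo σ (y t) (hy.bddPath.coefSobSq_ne_top t.2)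
  continuous_toFun := by
    rw [continuous_iff_continuousAt]
    intro t
    rw [ContinuousAt, tendsto_iff_edist_tendsto_0]
    have h : Tendsto (fun t' : Set.Icc (0:ℝ) T => coefSobNorm σ (fun k => y t' k - y t k))
        (nhds t) (nhds 0) := by
      refine (hy.tendsto t t.2).comp ?_
      rw [nhds_subtype_eq_comap_nhdsWithin]
      exact tendsto_comap
    refine h.congr fun t' => ?_
    rw [edist_eq_enorm_sub, ← coefSobNorm_ofEllTwo (σ := σ)]
    congr 1
    funext k
    rw [ofEllTwo_sub, ofEllTwo_toEllTwo, ofEllTwo_toEllTwo]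

lemma pathOf_ofPath (hT : 0 ≤ T) (hy : SobPath T σ y) (t : ℝ) :
    pathOf hT σ (ofPath y hy) t = y (Set.projIcc 0 T hT t) :=
  ofEllTwo_toEllTwo (hy.bddPath.coefSobSq_ne_top (Set.projIcc 0 T hT t).2)

lemma enorm_sub_apply_sq (hT : 0 ≤ T) (u v : C(Set.Icc (0:ℝ) T, ellTwo)) {t : ℝ}
    (ht : t ∈ Set.Icc 0 T) :
    ‖u ⟨t, ht⟩ - v ⟨t, ht⟩‖ₑ ^ 2
      = coefSobSq σ (fun k => pathOf hT σ u t k - pathOf hT σ v t k) := by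
  rw [← coefSobSq_ofEllTwo (σ := σ)]
  congr 1
  funext k
  rw [ofEllTwo_sub, pathOf, pathOf, Set.projIcc_of_mem hT ht]

/-- Existence for the Volterra equation `y = z - duh c y` by the contraction principle. -/
lemma exists_volterra (hT : 0 ≤ T) (hΓ : 0 ≤ Γ) (h0 : σ ≤ 0) (h1 : -1 ≤ σ)
    (hc : VorticityPath T Γ c) (hz : SobPath T σ z) :
    ∃ y, SobPath T σ y ∧ (∀ t, y t = y (Set.projIcc 0 T hT t)) ∧
      ∀ t ∈ Set.Icc 0 T, ∀ k, y t k = -duh c y t k + z t k := by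
  have hstep : ∀ u : C(Set.Icc (0:ℝ) T, ellTwo),
      SobPath T σ (fun t k => -duh c (pathOf hT σ u) t k + z t k) := fun u =>
    (sobPath_duh hT h0 h1 hc (sobPath_pathOf hT u).bddPath).neg.add hz
  set Φ : C(Set.Icc (0:ℝ) T, ellTwo) → C(Set.Icc (0:ℝ) T, ellTwo) := fun u => ofPath _ (hstep u)
    with hΦ
  have hΦapp : ∀ u t k, pathOf hT σ (Φ u) t k
      = -duh c (pathOf hT σ u) (Set.projIcc 0 T hT t) k + z (Set.projIcc 0 T hT t) k :=
    fun u t k => congrFun (pathOf_ofPath hT (hstep u) t) k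
  set J : ℝ → ℝ≥0∞ := fun t => ENNReal.ofReal kap * ∫⁻ r in Set.Ioc (0:ℝ) t, gradSq c r with hJ
  have hfin : ∀ t ≤ T, ∫⁻ r in Set.Ioc (0:ℝ) t, gradSq c r ≠ ∞ := fun t ht =>
    ne_top_of_le_ne_top ENNReal.ofReal_ne_top
      ((lintegral_mono_set (Set.Ioc_subset_Ioc_right ht)).trans hc.energy)
  have hiter : ∀ (u v : C(Set.Icc (0:ℝ) T, ellTwo)) (n : ℕ) (t : ℝ), t ∈ Set.Icc 0 T →
      coefSobSq σ (fun k => pathOf hT σ (Φ^[n] u) t k - pathOf hT σ (Φ^[n] v) t k)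
        ≤ J t ^ n / (n.factorial : ℝ≥0∞) * ‖u - v‖ₑ ^ 2 := by
    intro u v n
    induction n with
    | zero =>
      intro t ht
      rw [← enorm_sub_apply_sq hT _ _ ht]
      simp only [Function.iterate_zero, id_eq, pow_zero, Nat.factorial_zero, Nat.cast_one,
        div_one, one_mul]
      gcongr
      exact enorm_le_iff_norm_le.2 ((u - v).norm_coe_le_norm _)
    | succ n ih =>
      intro t ht
      simp only [Function.iterate_succ_apply']
      set u' := Φ^[n] u
      set v' := Φ^[n] v
      have hb := (sobPath_pathOf (σ := σ) hT (u' - v')).bddPath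
      have he : (fun k => pathOf hT σ (Φ u') t k - pathOf hT σ (Φ v') t k)
          = fun k => -duh c (pathOf hT σ (u' - v')) t k := by
        funext k
        rw [hΦapp, hΦapp, Set.projIcc_of_mem hT ht, pathOf_sub,
          duh_sub h0 h1 hc (sobPath_pathOf hT u').bddPath (sobPath_pathOf hT v').bddPath ht]
        simp only
        ring
      rw [he, coefSobSq_neg]
      refine (coefSobSq_duh_le h0 h1 hc hb ht).trans ?_
      calc _ ≤ ENNReal.ofReal kap * ∫⁻ s in Set.Ioc (0:ℝ) t, gradSq c s *
              (J s ^ n / (n.factorial : ℝ≥0∞)) * ‖u - v‖ₑ ^ 2 := by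
            gcongr _ * ?_
            refine setLIntegral_mono' measurableSet_Ioc fun s hs => ?_
            rw [mul_assoc]
            gcongr
            rw [pathOf_sub]
            exact ih s ⟨hs.1.le, hs.2.trans ht.2⟩
        _ = (ENNReal.ofReal kap * ∫⁻ s in Set.Ioc (0:ℝ) t, gradSq c s *
              (J s ^ n / (n.factorial : ℝ≥0∞))) * ‖u - v‖ₑ ^ 2 := by
            rw [lintegral_mul_const' _ _ (ENNReal.pow_ne_top enorm_ne_top), mul_assoc]
        _ ≤ _ := by
            gcongr
            exact volterra_step hc.measurable_gradSq ht.1 (hfin t ht.2) _ n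
  obtain ⟨n, hn⟩ : ∃ n : ℕ, (kap * Γ) ^ n / (n.factorial : ℝ) < 1 / 4 :=
    ((FloorSemiring.tendsto_pow_div_factorial_atTop (kap * Γ)).eventually
      (gt_mem_nhds (by norm_num))).exists
  have hJn : ∀ t ∈ Set.Icc 0 T, J t ^ n / (n.factorial : ℝ≥0∞) ≤ ENNReal.ofReal (1 / 4) := by
    intro t ht
    have hJt : J t ≤ ENNReal.ofReal (kap * Γ) := by
      rw [hJ, ENNReal.ofReal_mul kap_nonneg]
      exact mul_le_mul_right
        ((lintegral_mono_set (Set.Ioc_subset_Ioc_right ht.2)).trans hc.energy) _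
    calc J t ^ n / (n.factorial : ℝ≥0∞) ≤ ENNReal.ofReal (kap * Γ) ^ n / (n.factorial : ℝ≥0∞) := by
          gcongr
      _ = ENNReal.ofReal ((kap * Γ) ^ n / (n.factorial : ℝ)) := by
          rw [ENNReal.ofReal_div_of_pos (by positivity), ENNReal.ofReal_natCast,
            ENNReal.ofReal_pow (mul_nonneg kap_nonneg hΓ)]
      _ ≤ _ := ENNReal.ofReal_le_ofReal hn.le
  have hcontr : ContractingWith (1 / 2) Φ^[n] := by
    refine ⟨by norm_num [← NNReal.coe_lt_coe], LipschitzWith.of_dist_le_mul fun u v => ?_⟩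
    rw [ContinuousMap.dist_le (by positivity)]
    intro t
    have h := (hiter u v n t t.2).trans (mul_le_mul_left (hJn t t.2) _)
    rw [← enorm_sub_apply_sq hT _ _ t.2] at h
    have h' := ENNReal.toReal_mono
      (ENNReal.mul_ne_top ENNReal.ofReal_ne_top (ENNReal.pow_ne_top enorm_ne_top)) h
    rw [ENNReal.toReal_mul, ENNReal.toReal_pow, ENNReal.toReal_pow, toReal_enorm, toReal_enorm,
      ENNReal.toReal_ofReal (by norm_num)] at h'
    rw [dist_eq_norm, dist_eq_norm]
    refine (sq_le_sq₀ (norm_nonneg _) (by positivity)).1 ?_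
    simp only [NNReal.coe_div, NNReal.coe_one, NNReal.coe_ofNat]
    calc _ ≤ _ := h'
      _ = _ := by ring
  have hfix := hcontr.isFixedPt_fixedPoint_iterate
  set w := ContractingWith.fixedPoint Φ^[n] hcontr
  refine ⟨pathOf hT σ w, sobPath_pathOf hT w, fun t => ?_, fun t ht k => ?_⟩
  · rw [pathOf, pathOf, Set.projIcc_of_mem hT (Set.projIcc 0 T hT t).2]
  · have h := hΦapp w t k
    rwa [hfix, Set.projIcc_of_mem hT ht] at h

end

section

variable {T Γ σ : ℝ} {c y y₁ y₂ z : ℝ → (Fin 2 → ℤ) → ℂ}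

/-- The a priori bound for the Volterra equation `y = z - duh c y`. -/
lemma volterra_bound (hΓ : 0 ≤ Γ) (h0 : σ ≤ 0) (h1 : -1 ≤ σ) (hc : VorticityPath T Γ c)
    (hy : BddPath T σ y) (heq : ∀ t ∈ Set.Icc 0 T, ∀ k, y t k = -duh c y t k + z t k)
    {B : ℝ≥0∞} (hB : ∀ t ∈ Set.Icc 0 T, coefSobSq σ (z t) ≤ B) :
    ∀ t ∈ Set.Icc 0 T, coefSobSq σ (y t) ≤ 2 * B * ENNReal.ofReal (Real.exp (2 * kap * Γ)) := by
  obtain ⟨M, hM, hyM⟩ := hy.bdd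
  refine volterra_gronwall hc.measurable_gradSq hΓ (mul_nonneg zero_le_two kap_nonneg) hc.energy
    hM hyM fun t ht => ?_
  have he : y t = fun k => -duh c y t k + z t k := funext (heq t ht)
  calc coefSobSq σ (y t) = coefSobSq σ (fun k => -duh c y t k + z t k) := by rw [← he]
    _ ≤ 2 * (coefSobSq σ (fun k => -duh c y t k) + coefSobSq σ (z t)) := coefSobSq_add_le _ _ _
    _ ≤ 2 * (ENNReal.ofReal kap * (∫⁻ s in Set.Ioc (0:ℝ) t, gradSq c s * coefSobSq σ (y s))
          + B) := by
        rw [coefSobSq_neg]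
        gcongr
        exacts [coefSobSq_duh_le h0 h1 hc hy ht, hB t ht]
    _ = _ := by
        rw [ENNReal.ofReal_mul zero_le_two, ENNReal.ofReal_ofNat]
        ring

lemma BddPath.sub (h₁ : BddPath T σ y₁) (h₂ : BddPath T σ y₂) :
    BddPath T σ (fun t k => y₁ t k - y₂ t k) := by
  refine ⟨?_, fun k => (h₁.cont k).sub (h₂.cont k)⟩
  obtain ⟨M₁, hM₁, h₁⟩ := h₁.bdd
  obtain ⟨M₂, hM₂, h₂⟩ := h₂.bdd
  refine ⟨2 * (M₁ + M₂), ENNReal.mul_ne_top (by norm_num) (ENNReal.add_ne_top.2 ⟨hM₁, hM₂⟩),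
    fun t ht => ?_⟩
  simp only [sub_eq_add_neg]
  refine (coefSobSq_add_le _ _ _).trans ?_
  rw [coefSobSq_neg]
  gcongr
  exacts [h₁ t ht, h₂ t ht]

/-- Uniqueness for the Volterra equation `y = z - duh c y`. -/
lemma volterra_unique (hΓ : 0 ≤ Γ) (h0 : σ ≤ 0) (h1 : -1 ≤ σ) (hc : VorticityPath T Γ c)
    (hy₁ : BddPath T σ y₁) (hy₂ : BddPath T σ y₂)
    (h₁ : ∀ t ∈ Set.Icc 0 T, ∀ k, y₁ t k = -duh c y₁ t k + z t k)
    (h₂ : ∀ t ∈ Set.Icc 0 T, ∀ k, y₂ t k = -duh c y₂ t k + z t k) :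
    ∀ t ∈ Set.Icc 0 T, ∀ k, y₁ t k = y₂ t k := by
  intro t ht k
  have hb := volterra_bound (z := fun _ _ => 0) hΓ h0 h1 hc (hy₁.sub hy₂) (fun t ht k => by
      rw [duh_sub h0 h1 hc hy₁ hy₂ ht, h₁ t ht, h₂ t ht]
      ring)
    (B := 0) (fun t _ => by simp [coefSobSq]) t ht
  rw [mul_zero, zero_mul, nonpos_iff_eq_zero, coefSobSq_eq, ENNReal.tsum_eq_zero] at hb
  have hk := hb k
  rw [sq_eq_zero_iff, mul_eq_zero, enorm_eq_zero, sub_eq_zero] at hk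
  exact hk.resolve_left (by simpa using wt_pos σ k)

lemma znorm_neg (k : Fin 2 → ℤ) : znorm (-k) = znorm k := by simp [znorm]

lemma bsm_neg (l : Fin 2 → ℤ) (j : Fin 2) : bsm (-l) j = -bsm l j := by
  by_cases hl : l = 0
  · simp [bsm, hl]
  · rw [bsm, bsm, if_neg hl, if_neg (neg_ne_zero.2 hl), znorm_neg]
    split_ifs <;> simp only [Pi.neg_apply] <;> push_cast <;> ring

lemma star_bsm (l : Fin 2 → ℤ) (j : Fin 2) : star (bsm l j) = -bsm l j := by
  rw [Complex.star_def]
  by_cases hl : l = 0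
  · simp [bsm, hl]
  · rw [bsm, if_neg hl]
    split_ifs <;> simp only [map_div₀, map_mul, map_neg, map_pow, Complex.conj_I, map_ofNat,
      Complex.conj_ofReal, map_intCast] <;> ring

lemma star_eulerSymbol_neg (k l : Fin 2 → ℤ) :
    star (eulerSymbol (-k) (-l)) = -eulerSymbol k l := by
  have hkl : -k - -l = -(k - l) := by abel
  rw [eulerSymbol, eulerSymbol, hkl, star_sum, ← Finset.sum_neg_distrib]
  refine Finset.sum_congr rfl fun j _ => ?_
  rw [bsm_neg, bsm_neg, star_mul', star_add, star_neg, star_neg, star_bsm, star_bsm]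
  simp only [Pi.neg_apply, Int.cast_neg, star_neg, Complex.star_def, map_intCast]
  ring

lemma star_econv_neg {c : (Fin 2 → ℤ) → ℂ} (hc : ∀ k, c (-k) = star (c k))
    (a : (Fin 2 → ℤ) → ℂ) (k : Fin 2 → ℤ) :
    econv c (fun l => star (a (-l))) k = star (econv c a (-k)) := by
  have h2 : star (2 * (Real.pi : ℂ) * Complex.I) = -(2 * (Real.pi : ℂ) * Complex.I) := by
    simp only [Complex.star_def, map_mul, map_ofNat, Complex.conj_ofReal, Complex.conj_I]
    ring
  rw [econv, econv, star_mul', h2, Complex.star_def, Complex.conj_tsum, ← Complex.star_def,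
    ← (Equiv.neg (Fin 2 → ℤ)).tsum_eq, neg_mul, ← mul_neg, ← tsum_neg]
  congr 1
  refine tsum_congr fun l => ?_
  have hs := star_eulerSymbol_neg k (-l)
  have hl := hc (-k - l)
  rw [neg_neg] at hs
  rw [show -(-k - l) = k - -l by abel] at hl
  simp only [Equiv.neg_apply]
  rw [star_mul', star_mul', hs, hl, neg_neg]
  ring

lemma star_duh_neg (hc : ∀ s k, c s (-k) = star (c s k)) (t : ℝ) (k : Fin 2 → ℤ) :
    duh c (fun t l => star (y t (-l))) t k = star (duh c y t (-k)) := by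
  have hi : star (duh c y t (-k)) = ∫ s in Set.Ioc (0:ℝ) t, star (duhInt c y t (-k) s) :=
    integral_conj.symm
  rw [hi, duh]
  congr 1
  funext s
  rw [duhInt, duhInt, star_econv_neg (hc s), star_mul', znorm_neg]
  congr 1
  exact (Complex.conj_ofReal _).symm

lemma coefSobSq_star_neg (a : (Fin 2 → ℤ) → ℂ) :
    coefSobSq σ (fun k => star (a (-k))) = coefSobSq σ a := by
  rw [coefSobSq, coefSobSq, ← (Equiv.neg (Fin 2 → ℤ)).tsum_eq]
  refine tsum_congr fun k => ?_
  simp [znorm_neg]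

lemma BddPath.star_neg (hy : BddPath T σ y) : BddPath T σ (fun t l => star (y t (-l))) := by
  refine ⟨?_, fun k => (hy.cont (-k)).star⟩
  simpa only [coefSobSq_star_neg] using hy.bdd

lemma vorticityPath_fc {ξ0 : (Fin 2 → ℝ) → ℝ} (h2 : spLp 2 ξ0 < ∞) {ξ : ℝ → (Fin 2 → ℝ) → ℝ}
    (hξ : Measurable (Function.uncurry ξ)) (hzero : ∀ t ∈ Set.Icc (0:ℝ) T, fc (ξ t) 0 = 0)
    (hsup : (⨆ t ∈ Set.Icc (0:ℝ) T, spLp 2 (ξ t)) ≤ spLp 2 ξ0)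
    (hen : (∫⁻ t in Set.Icc (0:ℝ) T, fourierGradSq (ξ t)) ≤ spLp 2 ξ0 ^ 2) :
    VorticityPath T ((spLp 2 ξ0).toReal ^ 2) (fun s => fc (ξ s)) where
  meas := measurable_fc hξ
  zero := hzero
  sq_ne_top s hs := by
    refine tsum_fc_sq_ne_top (hξ.comp measurable_prodMk_left) (lt_of_le_of_lt ?_ h2)
    exact (le_iSup₂ (f := fun t (_ : t ∈ Set.Icc (0:ℝ) T) => spLp 2 (ξ t)) s hs).trans hsup
  energy := by
    rw [ENNReal.ofReal_pow ENNReal.toReal_nonneg, ENNReal.ofReal_toReal h2.ne]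
    refine (lintegral_mono fun s => ?_).trans
      ((lintegral_mono_set Set.Ioc_subset_Icc_self).trans hen)
    refine ENNReal.tsum_le_tsum fun p => ?_
    have hn := znorm_nonneg p
    rw [mul_pow, ← ENNReal.ofReal_pow hn]
    refine mul_le_mul_left (ENNReal.ofReal_le_ofReal ?_) _
    gcongr
    nlinarith [Real.pi_gt_three]

lemma isMildSol_iff {ξ : ℝ → (Fin 2 → ℝ) → ℝ} :
    IsMildSol T ξ z y ↔ ∀ t ∈ Set.Icc (0:ℝ) T, ∀ k : Fin 2 → ℤ,
      (∀ s ∈ Set.Ioc (0:ℝ) t,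
        Summable fun l => ‖eulerSymbol k l * fc (ξ s) (k - l) * y s l‖) ∧
      IntegrableOn (duhInt (fun s => fc (ξ s)) y t k) (Set.Ioc 0 t) ∧
      y t k = -duh (fun s => fc (ξ s)) y t k + z t k :=
  Iff.rfl

end

/-- Well-posedness of the mild equation
`y_t = −∫₀ᵗ P_{t−s}[(K∗y_s)·∇ξ_s + (K∗ξ_s)·∇y_s] ds + z_t` in `C⁰_t H^{β−1}(𝕋²)`,
for any mean-zero `ξ₀ ∈ L²(𝕋²)` and any `ξ` satisfying the Navier–Stokes energy
bounds: existence, uniqueness, linearity of the solution map `S : z ↦ y`, and the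
bound `‖Sz‖_{C⁰H^{β−1}} ≤ exp(C(1+T)(1+‖ξ₀‖²_{L²})) ‖z‖_{C⁰H^{β−1}}` with a
universal constant `C`. -/
theorem statement10 :
    ∃ C : ℝ, 0 < C ∧
      ∀ (T β : ℝ), 0 < T → β ∈ Set.Ioo (0:ℝ) 1 →
      ∀ ξ0 : (Fin 2 → ℝ) → ℝ, Measurable ξ0 → ZPeriodic ξ0 → spLp 2 ξ0 < ∞ →
        fc ξ0 0 = 0 →
      ∀ ξ : ℝ → (Fin 2 → ℝ) → ℝ, Measurable (Function.uncurry ξ) →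
        (∀ t, ZPeriodic (ξ t)) → (∀ t ∈ Set.Icc (0:ℝ) T, fc (ξ t) 0 = 0) →
        (⨆ t ∈ Set.Icc (0:ℝ) T, spLp 2 (ξ t)) ≤ spLp 2 ξ0 →
        (∫⁻ t in Set.Icc (0:ℝ) T, fourierGradSq (ξ t)) ≤ spLp 2 ξ0 ^ 2 →
        -- existence and uniqueness
        ((∀ z : ℝ → (Fin 2 → ℤ) → ℂ, CoefPathClass T (β - 1) z →
          ∃ y : ℝ → (Fin 2 → ℤ) → ℂ,
            CoefPathClass T (β - 1) y ∧ IsMildSol T ξ z y ∧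
            ∀ y' : ℝ → (Fin 2 → ℤ) → ℂ,
              CoefPathClass T (β - 1) y' → IsMildSol T ξ z y' →
              ∀ t ∈ Set.Icc (0:ℝ) T, ∀ k, y' t k = y t k) ∧
        -- linearity of the solution map
        (∀ (z1 z2 y1 y2 : ℝ → (Fin 2 → ℤ) → ℂ) (a b : ℝ),
          CoefPathClass T (β - 1) z1 → IsMildSol T ξ z1 y1 →
          CoefPathClass T (β - 1) z2 → IsMildSol T ξ z2 y2 →
          CoefPathClass T (β - 1) y1 → CoefPathClass T (β - 1) y2 →
          IsMildSol T ξ (fun t k => (a : ℂ) * z1 t k + (b : ℂ) * z2 t k)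
            (fun t k => (a : ℂ) * y1 t k + (b : ℂ) * y2 t k)) ∧
        -- the operator bound
        (∀ z y : ℝ → (Fin 2 → ℤ) → ℂ,
          CoefPathClass T (β - 1) z → CoefPathClass T (β - 1) y → IsMildSol T ξ z y →
          supCoefSob T (β - 1) y
            ≤ ENNReal.ofReal
                (Real.exp (C * (1 + T) * (1 + (spLp 2 ξ0).toReal ^ 2)))
              * supCoefSob T (β - 1) z)) := by
  refine ⟨kap + 1, by linarith [kap_nonneg], ?_⟩
  intro T β hT hβ ξ0 _ _ h2 _ ξ hξ _ hzero hsup hen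
  set Γ : ℝ := (spLp 2 ξ0).toReal ^ 2 with hΓdef
  have hΓ : 0 ≤ Γ := by positivity
  have h0 : β - 1 ≤ 0 := by linarith [hβ.2]
  have h1 : -1 ≤ β - 1 := by linarith [hβ.1]
  have hc : VorticityPath T Γ (fun s => fc (ξ s)) := vorticityPath_fc h2 hξ hzero hsup hen
  have hpath : ∀ {y}, CoefPathClass T (β - 1) y → SobPath T (β - 1) y := fun hy =>
    SobPath.of_contCoefSob hy.2.1 hy.2.2
  refine ⟨fun z hz => ?_, ?_, ?_⟩
  · obtain ⟨y, hy, hproj, heq⟩ := exists_volterra hT.le hΓ h0 h1 hc (hpath hz)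
    have hreal : ∀ t ∈ Set.Icc 0 T, ∀ k, star (y t (-k)) = y t k := by
      refine volterra_unique hΓ h0 h1 hc hy.bddPath.star_neg hy.bddPath (fun t ht k => ?_) heq
      rw [star_duh_neg (fun s k => fc_neg (ξ s) k), heq t ht, star_add, star_neg, hz.1, star_star]
    refine ⟨y, ⟨fun t k => ?_, contCoefSob_iff.2 hy.tendsto, hy.supCoefSob_lt_top⟩, ?_, ?_⟩
    · rw [hproj t, ← hreal _ (Set.projIcc 0 T hT.le t).2 k, star_star]
    · refine isMildSol_iff.2 fun t ht k => ⟨fun s hs => ?_, ?_, heq t ht k⟩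
      · exact hy.bddPath.summable h1 hc ⟨hs.1.le, hs.2.trans ht.2⟩ k
      · exact integrableOn_duhInt h0 h1 hc hy.bddPath ht k
    · intro y' hy' hsol
      exact volterra_unique hΓ h0 h1 hc (hpath hy').bddPath hy.bddPath
        (fun t ht k => (isMildSol_iff.1 hsol t ht k).2.2) heq
  · intro z1 z2 y1 y2 a b _ hs1 _ hs2 _ _
    refine isMildSol_iff.2 fun t ht k => ?_
    obtain ⟨s1, i1, e1⟩ := isMildSol_iff.1 hs1 t ht k
    obtain ⟨s2, i2, e2⟩ := isMildSol_iff.1 hs2 t ht k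
    refine ⟨fun s hs => ?_, integrableOn_duhInt_add_smul s1 s2 i1 i2 a b, ?_⟩
    · refine Summable.of_nonneg_of_le (fun _ => norm_nonneg _) (fun l => ?_)
        (((s1 s hs).mul_left ‖(a : ℂ)‖).add ((s2 s hs).mul_left ‖(b : ℂ)‖))
      rw [← norm_mul, ← norm_mul]
      refine (le_of_eq ?_).trans (norm_add_le _ _)
      congr 1
      ring
    · rw [duh_add_smul s1 s2 i1 i2, e1, e2]
      ring
  · intro z y hz hy hsol
    refine supCoefSob_le fun t ht => ?_
    refine (volterra_bound hΓ h0 h1 hc (hpath hy).bddPath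
      (fun t ht k => (isMildSol_iff.1 hsol t ht k).2.2)
      (fun t ht => coefSobSq_le_supCoefSob ht) t ht).trans ?_
    rw [mul_pow, mul_right_comm]
    refine mul_le_mul_left ?_ _
    rw [← ENNReal.ofReal_pow (Real.exp_pos _).le, ← Real.exp_nat_mul, ← ENNReal.ofReal_ofNat,
      ← ENNReal.ofReal_mul zero_le_two]
    refine ENNReal.ofReal_le_ofReal ?_
    have hk := kap_nonneg
    calc 2 * Real.exp (2 * kap * Γ) ≤ Real.exp 1 * Real.exp (2 * kap * Γ) := by
          gcongr
          linarith [Real.add_one_le_exp 1]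
      _ ≤ _ := by
          rw [← Real.exp_add]
          refine Real.exp_le_exp.2 ?_
          have hE : (kap + 1) * 1 * (1 + Γ) ≤ (kap + 1) * (1 + T) * (1 + Γ) := by
            gcongr
            linarith
          push_cast
          nlinarith [mul_nonneg hk hΓ]

end GaleatiLuo
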